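/- arXiv:1603.01357 — 4 statements merged into one kernel-verified Lean document; each statement's English description precedes it below -/
import Mathlib

section
/- Let X_1,…,X_n be points in ℝ^d. Then, as an identity of functions on ℝ^d, Σ_{∅≠I⊆{1,…,n}} (−1)^{#I−1} (−1)^{dim Π_I} 𝟙_{relint Π_I} = 𝟙_{Π}, where the sum is over all non-empty subsets I of {1,…,n}. -/
open scoped Classical
open Pointwise

/-- The dimension of a set: the dimension of its affine hull. -/
noncomputable def adim {d : ℕ} (s : Set (EuclideanSpace ℝ (Fin d))) : ℕ :=
  Module.finrank ℝ (affineSpan ℝ s).direction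

section

open Set Filter Topology

/-- The value of the indicator function of `A` at `t` minus its limit from the right at `t`. -/
noncomputable def indicatorJump (A : Set ℝ) (t : ℝ) : ℝ :=
  (if t ∈ A then 1 else 0) - if ∀ᶠ s in 𝓝[>] t, s ∈ A then 1 else 0

@[simp]
theorem indicatorJump_empty (t : ℝ) : indicatorJump ∅ t = 0 := by
  have : ¬ ∀ᶠ s in 𝓝[>] t, s ∈ (∅ : Set ℝ) := fun h => by simpa using h.exists
  rw [indicatorJump, if_neg this]
  simp

theorem Set.OrdConnected.eventually_nhdsGT_mem_or_notMem {A : Set ℝ} (hA : A.OrdConnected)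
    (t : ℝ) : (∀ᶠ s in 𝓝[>] t, s ∈ A) ∨ ∀ᶠ s in 𝓝[>] t, s ∉ A := by
  by_cases h : ∃ᶠ s in 𝓝[>] t, s ∈ A
  · left
    obtain ⟨a, ha, hta⟩ := (h.and_eventually self_mem_nhdsWithin).exists
    filter_upwards [Ioo_mem_nhdsGT hta] with s hs
    obtain ⟨b, hb, htb⟩ := (h.and_eventually (Ioo_mem_nhdsGT hs.1)).exists
    exact hA.out hb ha ⟨htb.2.le, hs.2.le⟩
  · right
    exact not_frequently.1 h

theorem sum_mul_indicatorJump {κ : Type*} (F : Finset κ) (c : κ → ℝ) (A : κ → Set ℝ) (B : Set ℝ)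
    (hA : ∀ J ∈ F, (A J).OrdConnected) (hB : B.OrdConnected)
    (h : ∀ t, ∑ J ∈ F, c J * (if t ∈ A J then 1 else 0) = if t ∈ B then 1 else 0) (t : ℝ) :
    ∑ J ∈ F, c J * indicatorJump (A J) t = indicatorJump B t := by
  have decided : ∀ {C : Set ℝ}, C.OrdConnected →
      ∀ᶠ s in 𝓝[>] t, (s ∈ C ↔ ∀ᶠ s in 𝓝[>] t, s ∈ C) := by
    intro C hC
    rcases hC.eventually_nhdsGT_mem_or_notMem t with h1 | h1
    · filter_upwards [h1] with s hs
      exact iff_of_true hs h1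
    · have h2 : ¬ ∀ᶠ s in 𝓝[>] t, s ∈ C := fun h2 => by
        obtain ⟨s, hs, hs'⟩ := (h1.and h2).exists
        exact hs hs'
      filter_upwards [h1] with s hs
      exact iff_of_false hs h2
  obtain ⟨s, hs, hsB⟩ := (((F.eventually_all).2 fun J hJ => decided (hA J hJ)).and
    (decided hB)).exists
  simp only [indicatorJump, mul_sub, Finset.sum_sub_distrib, h t]
  simp only [← hsB, ← h s]
  congr 1
  refine Finset.sum_congr rfl fun J hJ => ?_
  simp only [← hs J hJ]

theorem sum_indicatorJump_inter_isOpen {U : Set ℝ} (hU : IsOpen U) (hc : U.OrdConnected)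
    {T : Finset ℝ} (hT : sInf (Ici 0 ∩ U) ∈ T) :
    ∑ t ∈ T, indicatorJump (Ici 0 ∩ U) t =
      (if (0 : ℝ) ∈ U then 1 else 0) - if (Ioi 0 ∩ U).Nonempty then 1 else 0 := by
  set A := Ici 0 ∩ U
  have hA : A.OrdConnected := ordConnected_Ici.inter hc
  have hbdd : BddBelow A := ⟨0, fun t ht => ht.1⟩
  have hright : ∀ t ∈ A, ∀ᶠ s in 𝓝[>] t, s ∈ A := by
    intro t ht
    filter_upwards [self_mem_nhdsWithin, nhdsWithin_le_nhds (hU.mem_nhds ht.2)] with s hs hs'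
    exact ⟨mem_Ici.2 (le_trans ht.1 (le_of_lt hs)), hs'⟩
  have hjump : ∀ t, indicatorJump A t = if t = sInf A then
      (if A.Nonempty ∧ sInf A ∉ A then -1 else 0) else 0 := by
    intro t
    by_cases htA : t ∈ A
    · have : ¬ (t = sInf A ∧ A.Nonempty ∧ sInf A ∉ A) := by
        rintro ⟨rfl, -, h⟩
        exact h htA
      rw [← ite_and, if_neg this]
      simp [indicatorJump, htA, hright t htA]
    · have key : (∀ᶠ s in 𝓝[>] t, s ∈ A) ↔ t = sInf A ∧ A.Nonempty ∧ sInf A ∉ A := by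
        constructor
        · intro h
          obtain ⟨a, ha⟩ := h.exists
          have hle : ∀ b ∈ A, t ≤ b := by
            intro b hb
            by_contra! hbt
            obtain ⟨s, hs, hst⟩ := (h.and self_mem_nhdsWithin).exists
            exact htA (hA.out hb hs ⟨hbt.le, le_of_lt hst⟩)
          have : t = sInf A := by
            refine le_antisymm (le_csInf ⟨a, ha⟩ hle) (le_of_forall_gt_imp_ge_of_dense ?_)
            intro b hb
            obtain ⟨s, hs, hst⟩ := (h.and (Ioo_mem_nhdsGT hb)).exists
            exact (csInf_le hbdd hs).trans hst.2.le
          exact ⟨this, ⟨a, ha⟩, this ▸ htA⟩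
        · rintro ⟨rfl, hne, -⟩
          obtain ⟨a, ha⟩ := hne
          have hlt : sInf A < a := lt_of_le_of_ne (csInf_le hbdd ha) (fun h => htA (h ▸ ha))
          filter_upwards [Ioo_mem_nhdsGT hlt] with s hs
          obtain ⟨b, hb, hbs⟩ := exists_lt_of_csInf_lt ⟨a, ha⟩ hs.1
          exact hA.out hb ha ⟨hbs.le, hs.2.le⟩
      rw [← ite_and, indicatorJump, if_neg htA]
      simp only [key]
      split_ifs <;> simp
  simp only [hjump, Finset.sum_ite_eq', if_pos hT]
  by_cases h0 : (0 : ℝ) ∈ U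
  · have h0A : (0 : ℝ) ∈ A := ⟨mem_Ici.2 le_rfl, h0⟩
    have hinf : sInf A = 0 :=
      le_antisymm (csInf_le hbdd h0A) (le_csInf ⟨0, h0A⟩ fun t ht => ht.1)
    obtain ⟨s, hs, hs0⟩ := ((hright 0 h0A).and self_mem_nhdsWithin).exists
    rw [if_neg (by simp [hinf, h0A]), if_pos h0, if_pos ⟨s, hs0, hs.2⟩, sub_self]
  · have hAeq : A = Ioi 0 ∩ U := by
      ext t
      refine ⟨fun ht => ⟨mem_Ioi.2 (lt_of_le_of_ne ht.1 ?_), ht.2⟩,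
        fun ht => ⟨mem_Ici.2 (le_of_lt ht.1), ht.2⟩⟩
      rintro rfl
      exact h0 ht.2
    have hinf : sInf A ∉ A := by
      intro h
      have hopen : IsOpen A := hAeq ▸ isOpen_Ioi.inter hU
      have hleft : ∀ᶠ s in 𝓝[<] (sInf A), s ∈ A := nhdsWithin_le_nhds (hopen.mem_nhds h)
      obtain ⟨s, hs, hs'⟩ := (hleft.and self_mem_nhdsWithin).exists
      exact absurd (csInf_le hbdd hs) (not_le.2 hs')
    rw [if_neg h0, ← hAeq]
    by_cases hne : A.Nonempty <;> simp [hne, hinf]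

theorem sum_indicatorJump_inter_subsingleton {U : Set ℝ} (hU : U.Subsingleton)
    {T : Finset ℝ} (hT : sInf (Ici 0 ∩ U) ∈ T) :
    ∑ t ∈ T, indicatorJump (Ici 0 ∩ U) t =
      (if (0 : ℝ) ∈ U then 1 else 0) + if (Ioi 0 ∩ U).Nonempty then 1 else 0 := by
  rcases hU.eq_empty_or_singleton with rfl | ⟨a, rfl⟩
  · simp
  · by_cases ha : 0 ≤ a
    · have hA : Ici 0 ∩ {a} = ({a} : Set ℝ) := by simpa using ha
      rw [hA, csInf_singleton] at hT
      have hjump : ∀ t, indicatorJump {a} t = if t = a then 1 else 0 := by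
        intro t
        have : ¬ ∀ᶠ s in 𝓝[>] t, s ∈ ({a} : Set ℝ) := by
          intro h
          obtain ⟨b, hb, htb⟩ := (h.and self_mem_nhdsWithin).exists
          obtain ⟨c, hc, hcb⟩ := (h.and (Ioo_mem_nhdsGT htb)).exists
          exact hcb.2.ne (hc.trans hb.symm)
        rw [indicatorJump, if_neg this, sub_zero, mem_singleton_iff]
      rw [hA]
      simp only [hjump, Finset.sum_ite_eq', if_pos hT]
      rcases ha.eq_or_lt with rfl | ha'
      · simp
      · have h1 : Ioi 0 ∩ {a} = ({a} : Set ℝ) := by simpa using ha'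
        simp [h1, ha'.ne]
    · have h1 : Ici 0 ∩ {a} = (∅ : Set ℝ) := by simpa using ha
      have h2 : Ioi 0 ∩ {a} = (∅ : Set ℝ) := by simpa using le_of_not_ge ha
      have h3 : (0 : ℝ) ≠ a := fun h => ha h.le
      simp [h1, h2, h3]

theorem sum_indicatorJump_isClosed {B : Set ℝ} (hB : IsClosed B) (hc : B.OrdConnected)
    {T : Finset ℝ} (hT : sSup B ∈ T) :
    ∑ t ∈ T, indicatorJump B t = if B.Nonempty ∧ BddAbove B then 1 else 0 := by
  have hjump : ∀ t, indicatorJump B t =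
      if t = sSup B then (if B.Nonempty ∧ BddAbove B then 1 else 0) else 0 := by
    intro t
    rw [← ite_and, indicatorJump]
    by_cases htB : t ∈ B
    · have key : (∀ᶠ s in 𝓝[>] t, s ∈ B) ↔ ¬ (t = sSup B ∧ B.Nonempty ∧ BddAbove B) := by
        constructor
        · rintro h ⟨rfl, -, hb⟩
          obtain ⟨s, hs, hst⟩ := (h.and self_mem_nhdsWithin).exists
          exact absurd (le_csSup hb hs) (not_le.2 hst)
        · intro h
          have : ∃ a ∈ B, t < a := by
            by_contra! hle
            have hm : IsGreatest B t := ⟨htB, hle⟩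
            exact h ⟨hm.csSup_eq.symm, ⟨t, htB⟩, ⟨t, hle⟩⟩
          obtain ⟨a, ha, hta⟩ := this
          filter_upwards [Ioo_mem_nhdsGT hta] with s hs
          exact hc.out htB ha ⟨hs.1.le, hs.2.le⟩
      simp only [key, if_pos htB]
      split_ifs <;> simp_all
    · have h1 : ¬ ∀ᶠ s in 𝓝[>] t, s ∈ B := fun h =>
        htB (hB.mem_of_frequently_of_tendsto h.frequently (tendsto_id.mono_left nhdsWithin_le_nhds))
      have h2 : ¬ (t = sSup B ∧ B.Nonempty ∧ BddAbove B) := by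
        rintro ⟨rfl, h, hb⟩
        exact htB (hB.csSup_mem h hb)
      simp [htB, h1, h2]
  simp only [hjump, Finset.sum_ite_eq', if_pos hT]

section Comb

variable {ι E : Type*} [AddCommGroup E] [Module ℝ E]

/-- `z` is a linear combination of the vectors `Y i`, `i ∈ s`, with positive coefficients. -/
def IsPosComb (Y : ι → E) (s : Finset ι) (z : E) : Prop :=
  ∃ w : ι → ℝ, (∀ i ∈ s, 0 < w i) ∧ ∑ i ∈ s, w i • Y i = z

/-- `z` is a linear combination of the vectors `Y i`, `i ∈ s`, with nonnegative coefficients. -/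
def IsNonnegComb (Y : ι → E) (s : Finset ι) (z : E) : Prop :=
  ∃ w : ι → ℝ, (∀ i ∈ s, 0 ≤ w i) ∧ ∑ i ∈ s, w i • Y i = z

/-- The vectors `Y i`, `i ∈ s`, satisfy a nontrivial linear relation with nonnegative
coefficients. -/
def IsNonnegDependent (Y : ι → E) (s : Finset ι) : Prop :=
  ∃ w : ι → ℝ, (∀ i ∈ s, 0 ≤ w i) ∧ (∃ i ∈ s, 0 < w i) ∧ ∑ i ∈ s, w i • Y i = 0

/-- The sign of the face with support `s` in the Euler relation. -/
noncomputable def faceSign (Y : ι → E) (s : Finset ι) : ℝ :=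
  (-1) ^ (s.card + Module.finrank ℝ (Submodule.span ℝ (Y '' s)))

theorem sum_insert_update {s : Finset ι} {m : ι} (hm : m ∉ s) (Y : ι → E) (w : ι → ℝ) (t : ℝ) :
    ∑ i ∈ insert m s, Function.update w m t i • Y i = t • Y m + ∑ i ∈ s, w i • Y i := by
  rw [Finset.sum_insert hm, Function.update_self]
  congr 1
  refine Finset.sum_congr rfl fun i hi => ?_
  rw [Function.update_of_ne (ne_of_mem_of_not_mem hi hm)]

theorem isPosComb_insert {Y : ι → E} {s : Finset ι} {m : ι} (hm : m ∉ s) {z : E} :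
    IsPosComb Y (insert m s) z ↔ ∃ t : ℝ, 0 < t ∧ IsPosComb Y s (z - t • Y m) := by
  constructor
  · rintro ⟨w, hw, rfl⟩
    exact ⟨w m, hw m (Finset.mem_insert_self _ _), w,
      fun i hi => hw i (Finset.mem_insert_of_mem hi), by rw [Finset.sum_insert hm]; abel⟩
  · rintro ⟨t, ht, w, hw, h⟩
    refine ⟨Function.update w m t, fun i hi => ?_, by rw [sum_insert_update hm, h]; abel⟩
    rcases eq_or_ne i m with rfl | him
    · rwa [Function.update_self]
    · rw [Function.update_of_ne him]
      exact hw i (Finset.mem_of_mem_insert_of_ne hi him)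

theorem isNonnegComb_insert {Y : ι → E} {s : Finset ι} {m : ι} (hm : m ∉ s) {z : E} :
    IsNonnegComb Y (insert m s) z ↔ ∃ t : ℝ, 0 ≤ t ∧ IsNonnegComb Y s (z - t • Y m) := by
  constructor
  · rintro ⟨w, hw, rfl⟩
    exact ⟨w m, hw m (Finset.mem_insert_self _ _), w,
      fun i hi => hw i (Finset.mem_insert_of_mem hi), by rw [Finset.sum_insert hm]; abel⟩
  · rintro ⟨t, ht, w, hw, h⟩
    refine ⟨Function.update w m t, fun i hi => ?_, by rw [sum_insert_update hm, h]; abel⟩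
    rcases eq_or_ne i m with rfl | him
    · rwa [Function.update_self]
    · rw [Function.update_of_ne him]
      exact hw i (Finset.mem_of_mem_insert_of_ne hi him)

theorem isNonnegDependent_insert {Y : ι → E} {s : Finset ι} {m : ι} (hm : m ∉ s) :
    IsNonnegDependent Y (insert m s) ↔ IsNonnegDependent Y s ∨ IsNonnegComb Y s (-Y m) := by
  constructor
  · rintro ⟨w, hw, ⟨i, hi, hwi⟩, h⟩
    rw [Finset.sum_insert hm] at h
    have hws : ∀ i ∈ s, 0 ≤ w i := fun i hi => hw i (Finset.mem_insert_of_mem hi)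
    rcases (hw m (Finset.mem_insert_self _ _)).eq_or_lt with hwm | hwm
    · refine Or.inl ⟨w, hws, ⟨i, Finset.mem_of_mem_insert_of_ne hi ?_, hwi⟩, ?_⟩
      · rintro rfl
        exact hwi.ne hwm
      · simpa [← hwm] using h
    · refine Or.inr ⟨fun i => (w m)⁻¹ * w i, fun i hi => mul_nonneg (by positivity) (hws i hi), ?_⟩
      simp only [mul_smul, ← Finset.smul_sum]
      rw [eq_neg_of_add_eq_zero_right h, smul_neg, smul_smul, inv_mul_cancel₀ hwm.ne', one_smul]
  · rintro (⟨w, hw, ⟨i, hi, hwi⟩, h⟩ | ⟨w, hw, h⟩)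
    · refine ⟨Function.update w m 0, fun j hj => ?_, ⟨i, Finset.mem_insert_of_mem hi, ?_⟩, ?_⟩
      · rcases eq_or_ne j m with rfl | hjm
        · simp
        · rw [Function.update_of_ne hjm]
          exact hw j (Finset.mem_of_mem_insert_of_ne hj hjm)
      · rwa [Function.update_of_ne (ne_of_mem_of_not_mem hi hm)]
      · rw [sum_insert_update hm, h, zero_smul, add_zero]
    · refine ⟨Function.update w m 1, fun j hj => ?_, ⟨m, Finset.mem_insert_self _ _, by simp⟩, ?_⟩
      · rcases eq_or_ne j m with rfl | hjm
        · simp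
        · rw [Function.update_of_ne hjm]
          exact hw j (Finset.mem_of_mem_insert_of_ne hj hjm)
      · rw [sum_insert_update hm, h, one_smul, add_neg_cancel]

theorem IsNonnegComb.add {Y : ι → E} {s : Finset ι} {a b : E} (ha : IsNonnegComb Y s a)
    (hb : IsNonnegComb Y s b) : IsNonnegComb Y s (a + b) := by
  obtain ⟨v, hv, rfl⟩ := ha
  obtain ⟨w, hw, rfl⟩ := hb
  exact ⟨v + w, fun i hi => add_nonneg (hv i hi) (hw i hi), by
    simp [add_smul, Finset.sum_add_distrib]⟩

theorem IsNonnegComb.smul {Y : ι → E} {s : Finset ι} {a : E} (ha : IsNonnegComb Y s a)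
    {c : ℝ} (hc : 0 ≤ c) : IsNonnegComb Y s (c • a) := by
  obtain ⟨v, hv, rfl⟩ := ha
  exact ⟨c • v, fun i hi => mul_nonneg hc (hv i hi), by simp [mul_smul, Finset.smul_sum]⟩

theorem IsPosComb.mem_span {Y : ι → E} {s : Finset ι} {a : E} (ha : IsPosComb Y s a) :
    a ∈ Submodule.span ℝ (Y '' s) := by
  obtain ⟨w, -, rfl⟩ := ha
  exact Submodule.sum_mem _ fun i hi =>
    Submodule.smul_mem _ _ (Submodule.subset_span (Set.mem_image_of_mem Y hi))

theorem convex_setOf_isPosComb (Y : ι → E) (s : Finset ι) : Convex ℝ {z | IsPosComb Y s z} := by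
  rintro _ ⟨v, hv, rfl⟩ _ ⟨w, hw, rfl⟩ a b ha hb hab
  refine ⟨fun i => a * v i + b * w i, fun i hi => ?_, ?_⟩
  · rcases ha.eq_or_lt with rfl | ha'
    · have : b = 1 := by linarith
      simpa [this] using hw i hi
    · have := mul_pos ha' (hv i hi)
      have := mul_nonneg hb (hw i hi).le
      linarith
  · simp [add_smul, mul_smul, Finset.sum_add_distrib, Finset.smul_sum]

theorem convex_setOf_isNonnegComb (Y : ι → E) (s : Finset ι) :
    Convex ℝ {z | IsNonnegComb Y s z} :=
  fun _ hx _ hy _ _ ha hb _ => (hx.smul ha).add (hy.smul hb)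

theorem Convex.ordConnected_preimage_sub_smul {C : Set E} (hC : Convex ℝ C) (z y : E) :
    {t : ℝ | z - t • y ∈ C}.OrdConnected := by
  have heq : {t : ℝ | z - t • y ∈ C} = AffineMap.lineMap (k := ℝ) z (z - y) ⁻¹' C := by
    ext t
    simp only [mem_ofPred_eq, mem_preimage, AffineMap.lineMap_apply_module', sub_sub_cancel_left,
      smul_neg, neg_add_eq_sub]
  rw [heq]
  exact (hC.affine_preimage _).ordConnected

theorem isOpen_setOf_isPosComb_sub_smul {Y : ι → E} {s : Finset ι} {y : E}
    (hy : y ∈ Submodule.span ℝ (Y '' s)) (z : E) : IsOpen {t : ℝ | IsPosComb Y s (z - t • y)} := by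
  rw [isOpen_iff_mem_nhds]
  rintro t ⟨w, hw, h⟩
  obtain ⟨c, rfl⟩ := (Submodule.mem_span_image_finset_iff_exists_fun' ℝ).1 hy
  have hev : ∀ᶠ u in nhds t, ∀ i ∈ s, 0 < w i - (u - t) * c i := by
    rw [Finset.eventually_all]
    intro i hi
    have hcont : ContinuousAt (fun u : ℝ => w i - (u - t) * c i) t := by fun_prop
    exact hcont.eventually_const_lt (by simpa using hw i hi)
  filter_upwards [hev] with u hu
  refine ⟨fun i => w i - (u - t) * c i, hu, ?_⟩
  simp only [sub_smul, Finset.sum_sub_distrib, h, mul_smul, ← Finset.smul_sum]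
  abel

theorem subsingleton_setOf_isPosComb_sub_smul {Y : ι → E} {s : Finset ι} {y : E}
    (hy : y ∉ Submodule.span ℝ (Y '' s)) (z : E) :
    {t : ℝ | IsPosComb Y s (z - t • y)}.Subsingleton := by
  intro t ht u hu
  by_contra htu
  refine hy ((Submodule.smul_mem_iff _ (sub_ne_zero.2 htu)).1 ?_)
  have := Submodule.sub_mem _ hu.mem_span ht.mem_span
  convert this using 1
  rw [sub_smul]
  abel

@[simp]
theorem faceSign_empty (Y : ι → E) : faceSign Y ∅ = 1 := by
  rw [faceSign, Finset.coe_empty, Set.image_empty, Submodule.span_empty, finrank_bot]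
  simp

theorem faceSign_insert_of_mem_span {Y : ι → E} {s : Finset ι} {m : ι} (hm : m ∉ s)
    (h : Y m ∈ Submodule.span ℝ (Y '' s)) : faceSign Y (insert m s) = -faceSign Y s := by
  rw [faceSign, faceSign, Finset.card_insert_of_notMem hm, Finset.coe_insert, Set.image_insert_eq,
    Submodule.span_insert_eq_span h]
  ring

theorem faceSign_insert_of_notMem_span [Module.Finite ℝ E] {Y : ι → E} {s : Finset ι}
    {m : ι} (hm : m ∉ s)
    (h : Y m ∉ Submodule.span ℝ (Y '' s)) : faceSign Y (insert m s) = faceSign Y s := by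
  rw [faceSign, faceSign, Finset.card_insert_of_notMem hm, Finset.coe_insert, Set.image_insert_eq,
    Submodule.span_insert, sup_comm, Submodule.finrank_sup_span_singleton h]
  ring

end Comb

section Euler

variable {ι E : Type*} [NormedAddCommGroup E] [NormedSpace ℝ E]

theorem isClosed_setOf_isNonnegComb {Y : ι → E} {s : Finset ι} (h : ¬ IsNonnegDependent Y s) :
    IsClosed {z | IsNonnegComb Y s z} := by
  let f : (s → ℝ) →ₗ[ℝ] E := Fintype.linearCombination ℝ (fun i : s => Y i)
  have hf : Continuous f := f.continuous_of_finiteDimensional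
  have hf_apply : ∀ w : ι → ℝ, f (fun i => w i) = ∑ i ∈ s, w i • Y i := fun w =>
    Finset.sum_coe_sort s fun i => w i • Y i
  have himage : {z | IsNonnegComb Y s z} = f '' Ici 0 := by
    ext z
    constructor
    · rintro ⟨w, hw, rfl⟩
      exact ⟨fun i => w i, fun i => hw i i.2, hf_apply w⟩
    · rintro ⟨w, hw, rfl⟩
      refine ⟨fun i => if hi : i ∈ s then w ⟨i, hi⟩ else 0, fun i hi => ?_, ?_⟩
      · simpa [hi] using hw ⟨i, hi⟩
      · rw [← hf_apply]
        simp
  have hpos : ∀ w ∈ Metric.sphere (0 : s → ℝ) 1 ∩ Ici 0, 0 < ‖f w‖ := by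
    rintro w ⟨hw1, hw0⟩
    by_contra hfw
    have hfw0 : f w = 0 := by simpa using hfw
    have hne : ∃ i, w i ≠ 0 := by
      by_contra! hzero
      have : w = 0 := funext hzero
      simp [this] at hw1
    obtain ⟨i, hi⟩ := hne
    refine h ⟨fun i => if hi : i ∈ s then w ⟨i, hi⟩ else 0, fun i hi => ?_, ⟨i, i.2, ?_⟩, ?_⟩
    · simpa [hi] using hw0 ⟨i, hi⟩
    · simpa using lt_of_le_of_ne (hw0 i) (Ne.symm hi)
    · rw [← hf_apply, ← hfw0]
      simp
  obtain ⟨δ, hδ, hle⟩ :=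
    ((isCompact_sphere (0 : s → ℝ) 1).inter_right isClosed_Ici).exists_forall_le'
      hf.norm.continuousOn hpos
  have hbound : ∀ w ∈ Ici (0 : s → ℝ), δ * ‖w‖ ≤ ‖f w‖ := by
    intro w hw
    rcases eq_or_ne w 0 with rfl | hw0
    · simp
    · have hn : 0 < ‖w‖ := norm_pos_iff.2 hw0
      have := hle (‖w‖⁻¹ • w) ⟨by simp [norm_smul, hn.ne'],
        mem_Ici.2 (smul_nonneg (inv_nonneg.2 hn.le) (mem_Ici.1 hw))⟩
      rw [map_smul, norm_smul, norm_inv, norm_norm, inv_mul_eq_div, le_div_iff₀ hn] at this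
      exact this
  rw [himage]
  refine IsSeqClosed.isClosed fun u z hu huz => ?_
  choose w hw hwu using hu
  obtain ⟨M, hM⟩ := (Metric.isBounded_range_of_tendsto u huz).exists_norm_le
  have hwM : ∀ n, w n ∈ Metric.closedBall (0 : s → ℝ) (M / δ) := by
    intro n
    rw [mem_closedBall_zero_iff, le_div_iff₀' hδ]
    exact (hbound _ (hw n)).trans (hwu n ▸ hM _ (mem_range_self n))
  obtain ⟨v, -, φ, hφ, hv⟩ := tendsto_subseq_of_bounded Metric.isBounded_closedBall hwM
  refine ⟨v, isClosed_Ici.mem_of_tendsto hv (Eventually.of_forall fun n => hw _), ?_⟩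
  refine tendsto_nhds_unique ((hf.tendsto v).comp hv) ?_
  convert huz.comp hφ.tendsto_atTop using 1
  ext n
  simp [hwu]

theorem bddAbove_setOf_isNonnegComb_sub_smul {Y : ι → E} {s : Finset ι}
    (h : ¬ IsNonnegDependent Y s) {z y : E}
    (hne : {t : ℝ | 0 ≤ t ∧ IsNonnegComb Y s (z - t • y)}.Nonempty) :
    BddAbove {t : ℝ | 0 ≤ t ∧ IsNonnegComb Y s (z - t • y)} ↔ ¬ IsNonnegComb Y s (-y) := by
  constructor
  · rintro ⟨M, hM⟩ hy
    obtain ⟨t, ht0, ht⟩ := hne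
    have hmem : |M| + 1 + t ∈ {t : ℝ | 0 ≤ t ∧ IsNonnegComb Y s (z - t • y)} := by
      refine ⟨by positivity, ?_⟩
      convert ht.add (hy.smul (c := |M| + 1) (by positivity)) using 1
      module
    linarith [hM hmem, le_abs_self M]
  · intro hy
    by_contra hunb
    rw [not_bddAbove_iff] at hunb
    choose t ht htn using fun n : ℕ => hunb (n + 1)
    have htop : Tendsto t atTop atTop :=
      tendsto_atTop_mono (fun n => (lt_trans (by simp) (htn n)).le) tendsto_natCast_atTop_atTop
    have hlim : Tendsto (fun n => (t n)⁻¹ • z - y) atTop (𝓝 ((0 : ℝ) • z - y)) :=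
      (htop.inv_tendsto_atTop.smul_const z).sub_const y
    rw [zero_smul, zero_sub] at hlim
    refine hy ((isClosed_setOf_isNonnegComb h).mem_of_tendsto hlim
      (Eventually.of_forall fun n => ?_))
    have hpos : 0 < t n := lt_trans (by positivity) (htn n)
    have := (ht n).2.smul (inv_nonneg.2 hpos.le)
    rwa [smul_sub, inv_smul_smul₀ hpos.ne'] at this

/-- **Euler relation** for the polyhedron of nonnegative solutions of a linear system: the
alternating sum over its faces, which are indexed by their supports, is `1` if the polyhedron is
nonempty and bounded, and `0` otherwise. -/
theorem sum_faceSign_mul_isPosComb [FiniteDimensional ℝ E] (Y : ι → E) (s : Finset ι) (z : E) :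
    ∑ J ∈ s.powerset, faceSign Y J * (if IsPosComb Y J z then 1 else 0) =
      if IsNonnegComb Y s z ∧ ¬ IsNonnegDependent Y s then 1 else 0 := by
  induction s using Finset.induction_on generalizing z with
  | empty => simp [IsPosComb, IsNonnegComb, IsNonnegDependent]
  | insert m s hm ih =>
    set U : Finset ι → Set ℝ := fun J => {t | IsPosComb Y J (z - t • Y m)} with hU
    obtain ⟨A, hA⟩ : ∃ A : Finset ι → Set ℝ, ∀ J, A J = Ici 0 ∩ U J := ⟨_, fun _ => rfl⟩
    obtain ⟨B, hB⟩ : ∃ B : Set ℝ, B =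
      {t | 0 ≤ t ∧ IsNonnegComb Y s (z - t • Y m) ∧ ¬ IsNonnegDependent Y s} := ⟨_, rfl⟩
    set T : Finset ℝ := insert (sSup B) (s.powerset.image fun J => sInf (A J))
    have hUc : ∀ J, (U J).OrdConnected := fun J =>
      (convex_setOf_isPosComb Y J).ordConnected_preimage_sub_smul z (Y m)
    have hBc : B.OrdConnected := by
      by_cases hd : IsNonnegDependent Y s
      · simpa [hB, hd] using ordConnected_empty
      · simpa [hB, hd, ofPred_and, Ici_def] using (ordConnected_Ici (a := (0 : ℝ))).inter
          ((convex_setOf_isNonnegComb Y s).ordConnected_preimage_sub_smul z (Y m))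
    have hBclosed : IsClosed B := by
      by_cases hd : IsNonnegDependent Y s
      · simp [hB, hd]
      · have hcont : Continuous fun t : ℝ => z - t • Y m := by fun_prop
        simpa [hB, hd, ofPred_and, Ici_def] using (isClosed_Ici (a := (0 : ℝ))).inter
          ((isClosed_setOf_isNonnegComb hd).preimage hcont)
    have hface : ∀ J ∈ s.powerset, faceSign Y J * ∑ t ∈ T, indicatorJump (A J) t =
        faceSign Y J * (if IsPosComb Y J z then 1 else 0) +
          faceSign Y (insert m J) * (if IsPosComb Y (insert m J) z then 1 else 0) := by
      intro J hJ
      have hmJ : m ∉ J := fun h => hm (Finset.mem_powerset.1 hJ h)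
      have hJT : sInf (Ici 0 ∩ U J) ∈ T :=
        hA J ▸ Finset.mem_insert_of_mem (Finset.mem_image_of_mem _ hJ)
      have h0 : (0 : ℝ) ∈ U J ↔ IsPosComb Y J z := by simp [hU]
      have hins : (Ioi 0 ∩ U J).Nonempty ↔ IsPosComb Y (insert m J) z :=
        (isPosComb_insert hmJ).symm
      by_cases hspan : Y m ∈ Submodule.span ℝ (Y '' J)
      · rw [hA, sum_indicatorJump_inter_isOpen (U := U J)
            (isOpen_setOf_isPosComb_sub_smul hspan z) (hUc J) hJT,
          faceSign_insert_of_mem_span hmJ hspan]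
        simp only [h0, hins]
        ring
      · rw [hA, sum_indicatorJump_inter_subsingleton (U := U J)
            (subsingleton_setOf_isPosComb_sub_smul hspan z) hJT,
          faceSign_insert_of_notMem_span hmJ hspan]
        simp only [h0, hins]
        ring
    have hindicator : ∀ t, ∑ J ∈ s.powerset, faceSign Y J * (if t ∈ A J then 1 else 0) =
        if t ∈ B then 1 else 0 := by
      intro t
      by_cases ht : 0 ≤ t
      · simpa [hU, hA, hB, ht] using ih (z - t • Y m)
      · simp [hA, hB, ht]
    rw [Finset.sum_powerset_insert hm, ← Finset.sum_add_distrib, ← Finset.sum_congr rfl hface]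
    simp only [Finset.mul_sum]
    rw [Finset.sum_comm, Finset.sum_congr rfl fun t _ => sum_mul_indicatorJump s.powerset
      (faceSign Y) A B (fun J _ => hA J ▸ ordConnected_Ici.inter (hUc J)) hBc
      hindicator t, sum_indicatorJump_isClosed hBclosed hBc (Finset.mem_insert_self _ _)]
    refine if_congr ?_ rfl rfl
    rw [isNonnegDependent_insert hm, isNonnegComb_insert hm]
    by_cases hd : IsNonnegDependent Y s
    · simp [hB, hd]
    · have hBeq : B = {t : ℝ | 0 ≤ t ∧ IsNonnegComb Y s (z - t • Y m)} := by simp [hB, hd]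
      rw [hBeq, and_congr_right (bddAbove_setOf_isNonnegComb_sub_smul hd)]
      simp [hd, Set.Nonempty]

end Euler

section RelativeInterior

variable {ι E : Type*} [NormedAddCommGroup E] [NormedSpace ℝ E]

theorem mem_intrinsicInterior_iff_mem_nhdsWithin {s : Set E} {x : E} :
    x ∈ intrinsicInterior ℝ s ↔ x ∈ affineSpan ℝ s ∧ s ∈ 𝓝[(affineSpan ℝ s : Set E)] x := by
  rw [mem_intrinsicInterior]
  constructor
  · rintro ⟨y, hy, rfl⟩
    exact ⟨y.2, preimage_coe_mem_nhds_subtype.1 (mem_interior_iff_mem_nhds.1 hy)⟩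
  · rintro ⟨hx, h⟩
    exact ⟨⟨x, hx⟩, mem_interior_iff_mem_nhds.2 (preimage_coe_mem_nhds_subtype.2 h), rfl⟩

theorem mem_convexHull_image_iff {X : ι → E} {s : Finset ι} {x : E} :
    x ∈ convexHull ℝ (X '' s) ↔
      ∃ w : ι → ℝ, (∀ i ∈ s, 0 ≤ w i) ∧ ∑ i ∈ s, w i = 1 ∧ ∑ i ∈ s, w i • X i = x := by
  constructor
  · intro hx
    refine convexHull_min (t := {x | ∃ w : ι → ℝ, (∀ i ∈ s, 0 ≤ w i) ∧ ∑ i ∈ s, w i = 1 ∧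
      ∑ i ∈ s, w i • X i = x}) ?_ ?_ hx
    · rintro _ ⟨i, hi, rfl⟩
      refine ⟨Pi.single i 1, fun j _ => ?_, ?_, ?_⟩
      · by_cases hj : j = i <;> simp [hj]
      · simpa [Pi.single_apply] using hi
      · simpa [Pi.single_apply] using fun h => absurd (Finset.mem_coe.1 hi) h
    · rintro _ ⟨v, hv, hv1, rfl⟩ _ ⟨w, hw, hw1, rfl⟩ a b ha hb hab
      refine ⟨fun i => a * v i + b * w i, fun i hi =>
        add_nonneg (mul_nonneg ha (hv i hi)) (mul_nonneg hb (hw i hi)), ?_, ?_⟩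
      · rw [Finset.sum_add_distrib, ← Finset.mul_sum, ← Finset.mul_sum, hv1, hw1]
        linarith
      · simp [add_smul, mul_smul, Finset.sum_add_distrib, Finset.smul_sum]
  · rintro ⟨w, hw, hw1, rfl⟩
    exact (convex_convexHull ℝ _).sum_mem hw hw1 fun i hi =>
      subset_convexHull ℝ _ (mem_image_of_mem X hi)

theorem Convex.combo_mem_intrinsicInterior {C : Set E} (hC : Convex ℝ C) {u y : E} (hu : u ∈ C)
    (hy : y ∈ intrinsicInterior ℝ C) {ε : ℝ} (h0 : 0 < ε) (h1 : ε ≤ 1) :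
    AffineMap.lineMap u y ε ∈ intrinsicInterior ℝ C := by
  rw [mem_intrinsicInterior_iff_mem_nhdsWithin] at hy ⊢
  have hu' : u ∈ affineSpan ℝ C := subset_affineSpan ℝ C hu
  refine ⟨AffineMap.lineMap_mem ε hu' hy.1, ?_⟩
  have hinv : ∀ p, AffineMap.lineMap u (AffineMap.lineMap u p ε) ε⁻¹ = p := fun p => by
    simp [AffineMap.lineMap_apply, smul_smul, inv_mul_cancel₀ h0.ne']
  have hinv' : ∀ p, AffineMap.lineMap u (AffineMap.lineMap u p ε⁻¹) ε = p := fun p => by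
    simp [AffineMap.lineMap_apply, smul_smul, mul_inv_cancel₀ h0.ne']
  have hcont : Continuous fun p : E => AffineMap.lineMap u p ε⁻¹ := by
    simp only [AffineMap.lineMap_apply_module]
    fun_prop
  have htend : Tendsto (fun p : E => AffineMap.lineMap u p ε⁻¹)
      (𝓝[(affineSpan ℝ C : Set E)] (AffineMap.lineMap u y ε)) (𝓝[(affineSpan ℝ C : Set E)] y) := by
    have := hcont.continuousWithinAt (s := (affineSpan ℝ C : Set E))
      (x := AffineMap.lineMap u y ε) |>.tendsto_nhdsWithin (t := (affineSpan ℝ C : Set E))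
      fun p hp => AffineMap.lineMap_mem ε⁻¹ hu' hp
    rwa [hinv] at this
  filter_upwards [htend hy.2] with p hp
  rw [← hinv' p]
  exact hC.lineMap_mem hu hp ⟨h0.le, h1⟩

theorem mem_intrinsicInterior_convexHull_image_iff [FiniteDimensional ℝ E] {X : ι → E}
    {s : Finset ι} (hs : s.Nonempty) {x : E} :
    x ∈ intrinsicInterior ℝ (convexHull ℝ (X '' s)) ↔
      ∃ w : ι → ℝ, (∀ i ∈ s, 0 < w i) ∧ ∑ i ∈ s, w i = 1 ∧ ∑ i ∈ s, w i • X i = x := by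
  set C := convexHull ℝ (X '' s)
  have hC : Convex ℝ C := convex_convexHull ℝ _
  constructor
  · intro hx
    have hcard : (0 : ℝ) < s.card := by exact_mod_cast hs.card_pos
    set c : E := ∑ i ∈ s, (s.card : ℝ)⁻¹ • X i with hc
    have hcC : c ∈ C := mem_convexHull_image_iff.2
      ⟨fun _ => (s.card : ℝ)⁻¹, fun _ _ => by positivity, by simp [hcard.ne'], rfl⟩
    obtain ⟨hx', hxn⟩ := mem_intrinsicInterior_iff_mem_nhdsWithin.1 hx
    have hcont : Continuous fun ε : ℝ => AffineMap.lineMap x c (-ε) := by fun_prop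
    have htend : Tendsto (fun ε : ℝ => AffineMap.lineMap x c (-ε)) (𝓝 0)
        (𝓝[(affineSpan ℝ C : Set E)] x) := by
      refine tendsto_nhdsWithin_iff.2 ⟨?_, Eventually.of_forall fun ε =>
        AffineMap.lineMap_mem _ hx' (subset_affineSpan ℝ C hcC)⟩
      simpa using hcont.tendsto 0
    obtain ⟨ε, hε, hε0⟩ := (((htend.mono_left nhdsWithin_le_nhds).eventually hxn).and
      (self_mem_nhdsWithin : Ioi (0 : ℝ) ∈ 𝓝[>] 0)).exists
    have hε0 : 0 < ε := hε0
    obtain ⟨v, hv, hv1, hvx⟩ := mem_convexHull_image_iff.1 hε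
    refine ⟨fun i => (1 + ε)⁻¹ * (v i + ε * (s.card : ℝ)⁻¹), fun i hi => ?_, ?_, ?_⟩
    · have := hv i hi
      positivity
    · rw [← Finset.mul_sum, Finset.sum_add_distrib, hv1, Finset.sum_const, nsmul_eq_mul]
      field_simp
    · simp only [mul_smul, add_smul, ← Finset.smul_sum, Finset.sum_add_distrib, hvx] at hc ⊢
      rw [← hc, AffineMap.lineMap_apply_module, inv_smul_eq_iff₀ (by positivity)]
      module
  · rintro ⟨w, hw, hw1, rfl⟩
    have hne : C.Nonempty := (hs.to_set.image X).convexHull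
    obtain ⟨y, hy⟩ := hne.intrinsicInterior hC
    obtain ⟨v, hv, hv1, rfl⟩ := mem_convexHull_image_iff.1 (intrinsicInterior_subset hy)
    have hev : ∀ᶠ ε in 𝓝 (0 : ℝ), ∀ i ∈ s, 0 < w i - ε * v i := by
      rw [Finset.eventually_all]
      intro i hi
      have hcont : ContinuousAt (fun ε : ℝ => w i - ε * v i) 0 := by fun_prop
      exact hcont.eventually_const_lt (by simpa using hw i hi)
    obtain ⟨ε, hε, hε0, hε1⟩ := ((hev.filter_mono nhdsWithin_le_nhds).and
      (Ioo_mem_nhdsGT (zero_lt_one' ℝ))).exists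
    have h1ε : 0 < 1 - ε := sub_pos.2 hε1
    have hu : ∑ i ∈ s, ((1 - ε)⁻¹ * (w i - ε * v i)) • X i ∈ C := by
      refine mem_convexHull_image_iff.2 ⟨_, fun i hi => ?_, ?_, rfl⟩
      · exact mul_nonneg (inv_nonneg.2 h1ε.le) (hε i hi).le
      · rw [← Finset.mul_sum, Finset.sum_sub_distrib, ← Finset.mul_sum, hw1, hv1, mul_one,
          inv_mul_cancel₀ h1ε.ne']
    convert hC.combo_mem_intrinsicInterior hu hy hε0 hε1.le using 1
    rw [AffineMap.lineMap_apply_module]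
    simp only [mul_smul, ← Finset.smul_sum, sub_smul, Finset.sum_sub_distrib]
    rw [← sub_smul, smul_inv_smul₀ h1ε.ne', sub_add_cancel]

theorem mem_intrinsicInterior_convexHull_iff_isPosComb [FiniteDimensional ℝ E] {X : ι → E}
    {s : Finset ι} (hs : s.Nonempty) {x : E} :
    x ∈ intrinsicInterior ℝ (convexHull ℝ (X '' s)) ↔ IsPosComb (fun i => X i - x) s 0 := by
  rw [mem_intrinsicInterior_convexHull_image_iff hs]
  constructor
  · rintro ⟨w, hw, hw1, h⟩
    exact ⟨w, hw, by simp [smul_sub, h, ← Finset.sum_smul, hw1]⟩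
  · rintro ⟨w, hw, h⟩
    have hpos : 0 < ∑ i ∈ s, w i := Finset.sum_pos hw hs
    refine ⟨fun i => (∑ i ∈ s, w i)⁻¹ * w i, fun i hi => mul_pos (inv_pos.2 hpos) (hw i hi), ?_, ?_⟩
    · rw [← Finset.mul_sum, inv_mul_cancel₀ hpos.ne']
    · simp only [smul_sub, Finset.sum_sub_distrib, ← Finset.sum_smul, sub_eq_zero] at h
      simp only [mul_smul, ← Finset.smul_sum]
      rw [h, inv_smul_smul₀ hpos.ne']

theorem mem_convexHull_iff_isNonnegDependent {X : ι → E} {s : Finset ι} {x : E} :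
    x ∈ convexHull ℝ (X '' s) ↔ IsNonnegDependent (fun i => X i - x) s := by
  rw [mem_convexHull_image_iff]
  constructor
  · rintro ⟨w, hw, hw1, h⟩
    refine ⟨w, hw, ?_, by simp [smul_sub, h, ← Finset.sum_smul, hw1]⟩
    by_contra! hle
    linarith [Finset.sum_nonpos hle]
  · rintro ⟨w, hw, hne, h⟩
    have hpos : 0 < ∑ i ∈ s, w i := Finset.sum_pos' hw hne
    refine ⟨fun i => (∑ i ∈ s, w i)⁻¹ * w i,
      fun i hi => mul_nonneg (inv_nonneg.2 hpos.le) (hw i hi), ?_, ?_⟩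
    · rw [← Finset.mul_sum, inv_mul_cancel₀ hpos.ne']
    · simp only [smul_sub, Finset.sum_sub_distrib, ← Finset.sum_smul, sub_eq_zero] at h
      simp only [mul_smul, ← Finset.smul_sum]
      rw [h, inv_smul_smul₀ hpos.ne']

theorem direction_affineSpan_eq_span_sub {s : Set E} {x : E} (hx : x ∈ affineSpan ℝ s) :
    (affineSpan ℝ s).direction = Submodule.span ℝ ((· - x) '' s) := by
  have h : affineSpan ℝ (insert x s) = affineSpan ℝ s :=
    affineSpan_insert_eq_affineSpan ℝ hx
  rw [← h, direction_affineSpan, vectorSpan_eq_span_vsub_set_right ℝ (mem_insert x s)]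
  simp [image_insert_eq]

end RelativeInterior

end

/-- **Dual Cowan formula** (Theorem 1.2). As an identity of functions on `ℝ^d`,
`Σ_{∅ ≠ I ⊆ {1,…,n}} (−1)^{#I−1} (−1)^{dim Π_I} 𝟙_{relint Π_I} = 𝟙_Π`. -/
theorem cowan_dual (n d : ℕ) (X : Fin n → EuclideanSpace ℝ (Fin d))
    (x : EuclideanSpace ℝ (Fin d)) :
    ∑ I ∈ Finset.univ.powerset.filter (fun I : Finset (Fin n) => I.Nonempty),
        (-1 : ℝ) ^ (I.card - 1) * (-1 : ℝ) ^ adim (convexHull ℝ (X '' ↑I)) *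
          (intrinsicInterior ℝ (convexHull ℝ (X '' ↑I))).indicator (fun _ => (1 : ℝ)) x
      = (convexHull ℝ (Set.range X)).indicator (fun _ => (1 : ℝ)) x := by
  set Y : Fin n → EuclideanSpace ℝ (Fin d) := fun i => X i - x with hY
  have hterm : ∀ I ∈ Finset.univ.powerset.filter (fun I : Finset (Fin n) => I.Nonempty),
      (-1 : ℝ) ^ (I.card - 1) * (-1 : ℝ) ^ adim (convexHull ℝ (X '' ↑I)) *
          (intrinsicInterior ℝ (convexHull ℝ (X '' ↑I))).indicator (fun _ => (1 : ℝ)) x =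
        -(faceSign Y I * (if IsPosComb Y I 0 then 1 else 0)) := by
    intro I hI
    have hne : I.Nonempty := (Finset.mem_filter.1 hI).2
    by_cases hx : x ∈ intrinsicInterior ℝ (convexHull ℝ (X '' ↑I))
    · have hspan : x ∈ affineSpan ℝ (X '' ↑I) :=
        convexHull_subset_affineSpan _ (intrinsicInterior_subset hx)
      rw [Set.indicator_of_mem hx,
        if_pos ((mem_intrinsicInterior_convexHull_iff_isPosComb hne).1 hx), faceSign, adim,
        affineSpan_convexHull, direction_affineSpan_eq_span_sub hspan, Set.image_image]
      obtain ⟨k, hk⟩ : ∃ k, I.card = k + 1 := ⟨I.card - 1, by have := hne.card_pos; omega⟩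
      rw [hk, Nat.add_sub_cancel]
      ring
    · rw [Set.indicator_of_notMem hx,
        if_neg fun h => hx ((mem_intrinsicInterior_convexHull_iff_isPosComb hne).2 h)]
      simp
  have hempty : (Finset.univ.powerset.filter fun I : Finset (Fin n) => ¬ I.Nonempty) = {∅} := by
    ext I
    simp
  have hEuler := sum_faceSign_mul_isPosComb Y Finset.univ 0
  have hzero : IsNonnegComb Y Finset.univ 0 := ⟨0, by simp, by simp⟩
  have hpos : IsPosComb Y ∅ 0 := ⟨0, by simp, by simp⟩
  have hrange : Set.range X = X '' ↑(Finset.univ : Finset (Fin n)) := by simp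
  rw [← Finset.sum_filter_add_sum_filter_not _ (fun I : Finset (Fin n) => I.Nonempty), hempty,
    Finset.sum_singleton, faceSign_empty, if_pos hpos] at hEuler
  rw [Finset.sum_congr rfl hterm, Finset.sum_neg_distrib, Set.indicator_apply, hrange,
    mem_convexHull_iff_isNonnegDependent]
  by_cases hd : IsNonnegDependent Y Finset.univ
  · rw [if_neg fun h => h.2 hd] at hEuler
    rw [if_pos hd]
    linarith
  · rw [if_pos ⟨hzero, hd⟩] at hEuler
    rw [if_neg hd]
    linarith
end

section
/- Let X_1,…,X_n be points in ℝ^d whose convex hull Π has dimension d, and let F ⊆ ℝ^d be an affine subspace. For k = 1,…,n let c_k(F) denote the number of subsets I ⊆ {1,…,n} with #I = k such that F ∩ conv(X_i : i ∈ I) ≠ ∅. Then Σ_{k=1}^{n} (−1)^{k−1} c_k(F) equals (−1)^{d − dim F} if F meets the interior of Π, and equals 0 if F does not meet the interior of Π. -/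
open scoped Classical
open Pointwise

section AlternatingSum

variable {E ι : Type*} [AddCommGroup E] [Module ℝ E]

/-- `C` is a convex subset of the subspace `U` that is algebraically open in `U`. -/
structure IsOpenConvexIn (U : Submodule ℝ E) (C : Set E) : Prop where
  subset : C ⊆ U
  convex : Convex ℝ C
  exists_add_smul_mem : ∀ f ∈ C, ∀ u ∈ U, ∃ ε > (0 : ℝ), ∀ t, 0 ≤ t → t ≤ ε → f + t • u ∈ C

/-- The alternating sum, over subsets `I` of `s`, of the indicator that some point of `C` is
strictly positive under all the functionals indexed by `I`. -/
noncomputable def positiveSum (a : ι → E →ₗ[ℝ] ℝ) (s : Finset ι) (C : Set E) : ℤ :=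
  ∑ I ∈ s.powerset, (-1 : ℤ) ^ I.card * if ∃ f ∈ C, ∀ i ∈ I, 0 < a i f then 1 else 0

variable {U : Submodule ℝ E} {C : Set E}

lemma isOpenConvexIn_self (U : Submodule ℝ E) : IsOpenConvexIn U (U : Set E) :=
  ⟨subset_rfl, U.convex, fun _ hf _ hu =>
    ⟨1, one_pos, fun t _ _ => U.add_mem hf (U.smul_mem t hu)⟩⟩

lemma IsOpenConvexIn.inter_pos (hC : IsOpenConvexIn U C) (v : E →ₗ[ℝ] ℝ) :
    IsOpenConvexIn U (C ∩ {f | 0 < v f}) := by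
  refine ⟨Set.inter_subset_left.trans hC.subset,
    hC.convex.inter (convex_halfSpace_gt v.isLinear 0), ?_⟩
  rintro f ⟨hf, hvf⟩ u hu
  obtain ⟨ε, hε, h⟩ := hC.exists_add_smul_mem f hf u hu
  have hvf' : 0 < v f := hvf
  have hden : 0 < |v u| + 1 := by positivity
  refine ⟨min ε (v f / 2 / (|v u| + 1)), lt_min hε (by positivity), fun t ht htε => ?_⟩
  refine ⟨h t ht (htε.trans (min_le_left _ _)), ?_⟩
  have h1 : t * (|v u| + 1) ≤ v f / 2 := by
    rw [← le_div_iff₀ hden]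
    exact htε.trans (min_le_right _ _)
  have h2 : t * (-|v u|) ≤ t * v u := mul_le_mul_of_nonneg_left (neg_abs_le _) ht
  simp only [Set.mem_ofPred_eq, map_add, map_smul, smul_eq_mul]
  nlinarith

lemma IsOpenConvexIn.inter_neg (hC : IsOpenConvexIn U C) (v : E →ₗ[ℝ] ℝ) :
    IsOpenConvexIn U (C ∩ {f | v f < 0}) := by
  simpa using hC.inter_pos (-v)

lemma IsOpenConvexIn.inter_ker (hC : IsOpenConvexIn U C) (v : E →ₗ[ℝ] ℝ) :
    IsOpenConvexIn (U ⊓ LinearMap.ker v) (C ∩ {f | v f = 0}) := by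
  refine ⟨fun f hf => ⟨hC.subset hf.1, hf.2⟩,
    hC.convex.inter (convex_hyperplane v.isLinear 0), ?_⟩
  rintro f ⟨hf, hvf⟩ u ⟨hu, hvu⟩
  obtain ⟨ε, hε, h⟩ := hC.exists_add_smul_mem f hf u hu
  refine ⟨ε, hε, fun t ht htε => ⟨h t ht htε, ?_⟩⟩
  have h1 : v f = 0 := hvf
  have h2 : v u = 0 := hvu
  simp [h1, h2]

lemma IsOpenConvexIn.inter_forall_pos (hC : IsOpenConvexIn U C) (a : ι → E →ₗ[ℝ] ℝ)
    (I : Finset ι) : IsOpenConvexIn U (C ∩ {f | ∀ i ∈ I, 0 < a i f}) := by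
  induction I using Finset.induction_on with
  | empty => simpa using hC
  | insert j I _ ih =>
    convert ih.inter_pos (a j) using 1
    ext f
    simp only [Finset.forall_mem_insert, Set.mem_inter_iff, Set.mem_ofPred_eq]
    tauto

/-- If `v` does not vanish on `U`, the indicator of nonemptiness is additive when `C` is cut by
the hyperplane `v = 0`. -/
lemma IsOpenConvexIn.indicator_add_indicator (hC : IsOpenConvexIn U C) {v : E →ₗ[ℝ] ℝ}
    {u : E} (hu : u ∈ U) (hvu : 0 < v u) :
    (if C.Nonempty then 1 else 0 : ℤ) + (if (C ∩ {f | v f = 0}).Nonempty then 1 else 0)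
      = (if (C ∩ {f | 0 < v f}).Nonempty then 1 else 0)
        + (if (C ∩ {f | v f < 0}).Nonempty then 1 else 0) := by
  have zero_pos : (C ∩ {f | v f = 0}).Nonempty → (C ∩ {f | 0 < v f}).Nonempty := by
    rintro ⟨f, hf, hvf⟩
    obtain ⟨ε, hε, h⟩ := hC.exists_add_smul_mem f hf u hu
    refine ⟨f + ε • u, h ε hε.le le_rfl, ?_⟩
    have h1 : v f = 0 := hvf
    simp only [Set.mem_ofPred_eq, map_add, map_smul, smul_eq_mul, h1]
    nlinarith
  have zero_neg : (C ∩ {f | v f = 0}).Nonempty → (C ∩ {f | v f < 0}).Nonempty := by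
    rintro ⟨f, hf, hvf⟩
    obtain ⟨ε, hε, h⟩ := hC.exists_add_smul_mem f hf (-u) (U.neg_mem hu)
    refine ⟨f + ε • -u, h ε hε.le le_rfl, ?_⟩
    have h1 : v f = 0 := hvf
    simp only [Set.mem_ofPred_eq, map_add, map_smul, map_neg, smul_eq_mul, h1]
    nlinarith
  have both_zero : (C ∩ {f | 0 < v f}).Nonempty → (C ∩ {f | v f < 0}).Nonempty →
      (C ∩ {f | v f = 0}).Nonempty := by
    rintro ⟨f, hf, hvf⟩ ⟨g, hg, hvg⟩
    have hvf' : 0 < v f := hvf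
    have hvg' : v g < 0 := hvg
    have hden : 0 < v f - v g := by linarith
    refine ⟨(-v g / (v f - v g)) • f + (v f / (v f - v g)) • g,
      hC.convex hf hg (div_nonneg (by linarith) hden.le) (by positivity) ?_, ?_⟩
    · field_simp
      ring
    · simp only [Set.mem_ofPred_eq, map_add, map_smul, smul_eq_mul]
      field_simp
      ring
  have trichotomy : C.Nonempty ↔ (C ∩ {f | 0 < v f}).Nonempty ∨ (C ∩ {f | v f < 0}).Nonempty := by
    constructor
    · rintro ⟨f, hf⟩
      rcases lt_trichotomy (v f) 0 with h | h | h
      · exact Or.inr ⟨f, hf, h⟩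
      · exact Or.inl (zero_pos ⟨f, hf, h⟩)
      · exact Or.inl ⟨f, hf, h⟩
    · rintro (⟨f, hf, -⟩ | ⟨f, hf, -⟩) <;> exact ⟨f, hf⟩
  split_ifs <;> first | rfl | (exfalso; tauto)

lemma positiveSum_insert [DecidableEq ι] (a : ι → E →ₗ[ℝ] ℝ) {s : Finset ι} {j : ι}
    (hj : j ∉ s) (C : Set E) :
    positiveSum a (insert j s) C = positiveSum a s C - positiveSum a s (C ∩ {f | 0 < a j f}) := by
  unfold positiveSum
  rw [Finset.sum_powerset_insert hj, sub_eq_add_neg, ← Finset.sum_neg_distrib]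
  congr 1
  refine Finset.sum_congr rfl fun I hI => ?_
  have hjI : j ∉ I := fun h => hj (Finset.mem_powerset.1 hI h)
  rw [Finset.card_insert_of_notMem hjI, pow_succ]
  have : (∃ f ∈ C, ∀ i ∈ insert j I, 0 < a i f) ↔
      ∃ f ∈ C ∩ {f | 0 < a j f}, ∀ i ∈ I, 0 < a i f := by
    simp only [Finset.forall_mem_insert, Set.mem_inter_iff, Set.mem_ofPred_eq, and_assoc]
  simp only [this]
  ring

lemma positiveSum_empty_set (a : ι → E →ₗ[ℝ] ℝ) (s : Finset ι) :
    positiveSum a s (∅ : Set E) = 0 := by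
  simp [positiveSum]

lemma IsOpenConvexIn.positiveSum_add (hC : IsOpenConvexIn U C) (a : ι → E →ₗ[ℝ] ℝ)
    (s : Finset ι) {v : E →ₗ[ℝ] ℝ} {u : E} (hu : u ∈ U) (hvu : 0 < v u) :
    positiveSum a s C + positiveSum a s (C ∩ {f | v f = 0})
      = positiveSum a s (C ∩ {f | 0 < v f}) + positiveSum a s (C ∩ {f | v f < 0}) := by
  unfold positiveSum
  rw [← Finset.sum_add_distrib, ← Finset.sum_add_distrib]
  refine Finset.sum_congr rfl fun I _ => ?_
  have key := (hC.inter_forall_pos a I).indicator_add_indicator hu hvu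
  have swap (P : Set E) : (∃ f ∈ C ∩ P, ∀ i ∈ I, 0 < a i f) ↔
      (C ∩ {f | ∀ i ∈ I, 0 < a i f} ∩ P).Nonempty := by
    rw [Set.inter_right_comm]
    rfl
  have self : (∃ f ∈ C, ∀ i ∈ I, 0 < a i f) ↔ (C ∩ {f | ∀ i ∈ I, 0 < a i f}).Nonempty := Iff.rfl
  simp only [swap, self, ← mul_add, key]

/-- Either `v` vanishes on `U` or it is positive somewhere on `U`. -/
lemma forall_eq_zero_or_exists_pos (U : Submodule ℝ E) (v : E →ₗ[ℝ] ℝ) :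
    (∀ u ∈ U, v u = 0) ∨ ∃ u ∈ U, 0 < v u := by
  by_contra! h
  obtain ⟨⟨u, hu, hne⟩, hle⟩ := h
  have h1 := hle u hu
  have h2 := hle (-u) (U.neg_mem hu)
  rw [map_neg] at h2
  exact hne (by linarith)

lemma positiveSum_insert_of_eq_zero [DecidableEq ι] {a : ι → E →ₗ[ℝ] ℝ} {s : Finset ι} {j : ι}
    (hj : j ∉ s) (h : ∀ f ∈ C, a j f = 0) :
    positiveSum a (insert j s) C = positiveSum a s C := by
  have : C ∩ {f | 0 < a j f} = ∅ := by
    ext f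
    simp only [Set.mem_inter_iff, Set.mem_ofPred_eq, Set.mem_empty_iff_false, iff_false, not_and,
      not_lt]
    exact fun hf => (h f hf).le
  rw [positiveSum_insert a hj, this, positiveSum_empty_set, sub_zero]

lemma IsOpenConvexIn.positiveSum_insert [DecidableEq ι] (hC : IsOpenConvexIn U C)
    {a : ι → E →ₗ[ℝ] ℝ} {s : Finset ι} {j : ι} (hj : j ∉ s) {u : E} (hu : u ∈ U)
    (hau : 0 < a j u) :
    positiveSum a (insert j s) C =
      positiveSum a s (C ∩ {f | a j f < 0}) - positiveSum a s (C ∩ {f | a j f = 0}) := by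
  rw [_root_.positiveSum_insert a hj]
  linarith [hC.positiveSum_add a s hu hau]

/-- The alternating sum vanishes if no point of `C` is nonpositive under all functionals. -/
lemma IsOpenConvexIn.positiveSum_eq_zero (a : ι → E →ₗ[ℝ] ℝ) (s : Finset ι)
    (hC : IsOpenConvexIn U C) (h : ∀ f ∈ C, ∃ i ∈ s, 0 < a i f) : positiveSum a s C = 0 := by
  induction s using Finset.induction_on generalizing U C with
  | empty =>
    have : C = ∅ := Set.eq_empty_of_forall_notMem fun f hf => by simpa using h f hf
    rw [this, positiveSum_empty_set]
  | insert j s hj ih =>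
    have drop (f : E) (hf : f ∈ C) (hjf : a j f ≤ 0) : ∃ i ∈ s, 0 < a i f := by
      obtain ⟨i, hi, hpos⟩ := h f hf
      rcases Finset.mem_insert.1 hi with rfl | hi
      · exact absurd hpos hjf.not_gt
      · exact ⟨i, hi, hpos⟩
    rcases forall_eq_zero_or_exists_pos U (a j) with h0 | ⟨u, hu, hau⟩
    · rw [positiveSum_insert_of_eq_zero hj fun f hf => h0 f (hC.subset hf)]
      exact ih hC fun f hf => drop f hf (h0 f (hC.subset hf)).le
    · rw [hC.positiveSum_insert hj hu hau,
        ih (hC.inter_neg (a j)) fun f hf => drop f hf.1 (le_of_lt hf.2),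
        ih (hC.inter_ker (a j)) fun f hf => drop f hf.1 (le_of_eq hf.2), sub_zero]

lemma finrank_inf_ker_add_one [FiniteDimensional ℝ E] {v : E →ₗ[ℝ] ℝ} {u : E} (hu : u ∈ U)
    (hvu : v u ≠ 0) :
    Module.finrank ℝ (U ⊓ LinearMap.ker v : Submodule ℝ E) + 1 = Module.finrank ℝ U := by
  have hsurj : v.domRestrict U ≠ 0 := fun h0 => hvu (LinearMap.congr_fun h0 ⟨u, hu⟩)
  have hker := Module.Dual.finrank_ker_add_one_of_ne_zero (f := v.domRestrict U) hsurj
  rw [← hker, LinearMap.ker_domRestrict, ← Submodule.finrank_map_subtype_eq,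
    Submodule.map_comap_subtype]

/-- If only the zero vector of `U` is nonpositive under all functionals, then the alternating sum
is the parity of the dimension of `U`. -/
lemma positiveSum_eq_neg_one_pow [FiniteDimensional ℝ E] (a : ι → E →ₗ[ℝ] ℝ) (s : Finset ι)
    (U : Submodule ℝ E) (h : ∀ f ∈ U, (∀ i ∈ s, a i f ≤ 0) → f = 0) :
    positiveSum a s (U : Set E) = (-1) ^ Module.finrank ℝ U := by
  induction s using Finset.induction_on generalizing U with
  | empty =>
    have : U = ⊥ := (Submodule.eq_bot_iff U).2 fun f hf => h f hf (by simp)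
    subst this
    simp [positiveSum]
  | insert j s hj ih =>
    rcases forall_eq_zero_or_exists_pos U (a j) with h0 | ⟨u, hu, hau⟩
    · rw [positiveSum_insert_of_eq_zero hj h0]
      exact ih U fun f hf hs => h f hf (Finset.forall_mem_insert _ _ _ |>.2 ⟨(h0 f hf).le, hs⟩)
    · have hneg : positiveSum a s ((U : Set E) ∩ {f | a j f < 0}) = 0 := by
        refine ((isOpenConvexIn_self U).inter_neg (a j)).positiveSum_eq_zero a s ?_
        rintro f ⟨hf, hjf⟩
        by_contra! hs
        have hjf' : a j f < 0 := hjf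
        have := h f hf (Finset.forall_mem_insert _ _ _ |>.2 ⟨hjf'.le, hs⟩)
        simp [this] at hjf'
      have hker : positiveSum a s ((U : Set E) ∩ {f | a j f = 0}) =
          (-1) ^ Module.finrank ℝ (U ⊓ LinearMap.ker (a j) : Submodule ℝ E) := by
        refine ih (U ⊓ LinearMap.ker (a j)) ?_
        rintro f ⟨hf, hjf⟩ hs
        have hjf' : a j f = 0 := hjf
        exact h f hf (Finset.forall_mem_insert _ _ _ |>.2 ⟨hjf'.le, hs⟩)
      rw [(isOpenConvexIn_self U).positiveSum_insert hj hu hau, hneg, hker,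
        ← finrank_inf_ker_add_one hu hau.ne', pow_succ]
      ring

/-- The alternating sum vanishes if some vector of `U` is nonnegative under all functionals and
positive under at least one of them. -/
lemma positiveSum_eq_zero_of_nonneg (a : ι → E →ₗ[ℝ] ℝ) (s : Finset ι) (U : Submodule ℝ E)
    {h : E} (hU : h ∈ U) (hs : ∀ i ∈ s, 0 ≤ a i h) {j : ι} (hj : j ∈ s) (hjh : 0 < a j h) :
    positiveSum a s (U : Set E) = 0 := by
  rw [← Finset.insert_erase hj, positiveSum_insert a (Finset.notMem_erase j s), sub_eq_zero]
  unfold positiveSum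
  refine Finset.sum_congr rfl fun I hI => ?_
  have hIs : I ⊆ s := (Finset.mem_powerset.1 hI).trans (Finset.erase_subset _ _)
  congr 2
  refine propext ⟨?_, fun ⟨f, hf, hfI⟩ => ⟨f, hf.1, hfI⟩⟩
  rintro ⟨f, hf, hfI⟩
  set t := (|a j f| + 1) / a j h with ht
  have htpos : 0 < t := by positivity
  refine ⟨f + t • h, ⟨U.add_mem hf (U.smul_mem t hU), ?_⟩, fun i hi => ?_⟩
  · have : t * a j h = |a j f| + 1 := by rw [ht]; field_simp
    simp only [Set.mem_ofPred_eq, map_add, map_smul, smul_eq_mul, this]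
    linarith [neg_abs_le (a j f)]
  · have h1 := mul_nonneg htpos.le (hs i (hIs hi))
    simp only [map_add, map_smul, smul_eq_mul]
    linarith [hfI i hi]

end AlternatingSum

section Separation

open scoped InnerProductSpace

variable {E : Type*} [NormedAddCommGroup E] [InnerProductSpace ℝ E]

/-- A linear functional bounded below on an affine subspace is constant on it. -/
lemma AffineSubspace.apply_direction_eq_zero_of_forall_le {F : AffineSubspace ℝ E}
    {f : E →L[ℝ] ℝ} {p : E} (hp : p ∈ F) {c : ℝ} (h : ∀ x ∈ F, c ≤ f x) {v : E}
    (hv : v ∈ F.direction) : f v = 0 := by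
  by_contra hne
  have hmem := AffineSubspace.vadd_mem_of_mem_direction
    (F.direction.smul_mem ((c - 1 - f p) / f v) hv) hp
  have := h _ hmem
  rw [vadd_eq_add, map_add, map_smul, smul_eq_mul, div_mul_cancel₀ _ hne] at this
  linarith

/-- If an affine subspace meets the interior of a polytope, then no nonzero vector orthogonal to
it weakly separates it from all the vertices. -/
lemma AffineSubspace.eq_zero_of_inter_interior_nonempty {ι : Type*} {F : AffineSubspace ℝ E}
    {p : E} (hp : p ∈ F) (X : ι → E)
    (hint : ((F : Set E) ∩ interior (convexHull ℝ (Set.range X))).Nonempty) {u : E}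
    (hu : u ∈ F.directionᗮ) (hle : ∀ i, ⟪u, X i - p⟫_ℝ ≤ 0) : u = 0 := by
  obtain ⟨x, hxF, hx⟩ := hint
  have hsub : convexHull ℝ (Set.range X) ⊆ {y | ⟪u, y⟫_ℝ ≤ ⟪u, p⟫_ℝ} := by
    refine convexHull_min ?_ (convex_halfSpace_le (innerₛₗ ℝ u).isLinear _)
    rintro _ ⟨i, rfl⟩
    have := hle i
    rw [inner_sub_right] at this
    simpa using this
  have hcont : Filter.Tendsto (fun t : ℝ => x + t • u) (nhdsWithin 0 (Set.Ioi 0)) (nhds x) := by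
    have : Continuous fun t : ℝ => x + t • u := by fun_prop
    simpa using (this.tendsto 0).mono_left nhdsWithin_le_nhds
  obtain ⟨t, htmem, ht⟩ := ((hcont.eventually (mem_interior_iff_mem_nhds.1 hx)).and
    self_mem_nhdsWithin).exists
  have ht' : (0 : ℝ) < t := ht
  have h1 : ⟪u, x + t • u⟫_ℝ ≤ ⟪u, p⟫_ℝ := hsub htmem
  have h2 := Submodule.inner_left_of_mem_orthogonal
    (AffineSubspace.vsub_mem_direction hxF hp) hu
  rw [vsub_eq_sub, inner_sub_right] at h2
  rw [inner_add_right, inner_smul_right] at h1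
  have h3 : ⟪u, u⟫_ℝ ≤ 0 := by nlinarith
  exact real_inner_self_nonpos.1 h3

variable [FiniteDimensional ℝ E]

/-- A functional bounded below on `F` is represented by a vector orthogonal to its direction. -/
lemma AffineSubspace.exists_mem_orthogonal_of_forall_le {F : AffineSubspace ℝ E}
    {f : E →L[ℝ] ℝ} {p : E} (hp : p ∈ F) {c : ℝ} (h : ∀ x ∈ F, c ≤ f x) :
    ∃ u ∈ F.directionᗮ, ∀ x, ⟪u, x - p⟫_ℝ = f p - f x := by
  refine ⟨-(InnerProductSpace.toDual ℝ E).symm f, ?_, fun x => ?_⟩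
  · rw [Submodule.mem_orthogonal']
    intro v hv
    rw [inner_neg_left, InnerProductSpace.toDual_symm_apply,
      F.apply_direction_eq_zero_of_forall_le hp h hv, neg_zero]
  · rw [inner_neg_left, InnerProductSpace.toDual_symm_apply, map_sub]
    ring

/-- An affine subspace misses a polytope iff some vector orthogonal to it strictly separates it
from all the vertices. -/
lemma AffineSubspace.inter_convexHull_image_nonempty_iff {ι : Type*} {F : AffineSubspace ℝ E}
    {p : E} (hp : p ∈ F) (X : ι → E) (I : Finset ι) :
    ((F : Set E) ∩ convexHull ℝ (X '' I)).Nonempty ↔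
      ¬ ∃ u ∈ F.directionᗮ, ∀ i ∈ I, 0 < ⟪u, X i - p⟫_ℝ := by
  constructor
  · rintro ⟨x, hxF, hx⟩ ⟨u, hu, hpos⟩
    have hsub : convexHull ℝ (X '' I) ⊆ {y | ⟪u, p⟫_ℝ < ⟪u, y⟫_ℝ} := by
      refine convexHull_min ?_ (convex_halfSpace_gt (innerₛₗ ℝ u).isLinear _)
      rintro _ ⟨i, hi, rfl⟩
      have := hpos i hi
      rw [inner_sub_right] at this
      simpa using this
    have h1 : ⟪u, p⟫_ℝ < ⟪u, x⟫_ℝ := hsub hx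
    have h2 := Submodule.inner_left_of_mem_orthogonal
      (AffineSubspace.vsub_mem_direction hxF hp) hu
    rw [vsub_eq_sub, inner_sub_right] at h2
    linarith
  · intro hno
    by_contra hempty
    rw [Set.not_nonempty_iff_eq_empty] at hempty
    obtain ⟨f, a, b, hfa, hab, hfb⟩ := geometric_hahn_banach_compact_closed
      (convex_convexHull ℝ (X '' (I : Set ι))) ((I.finite_toSet.image X).isCompact_convexHull ℝ)
      F.convex F.closed_of_finiteDimensional
      (Set.disjoint_iff_inter_eq_empty.2 (by rwa [Set.inter_comm]))
    obtain ⟨u, hu, huf⟩ := F.exists_mem_orthogonal_of_forall_le hp fun x hx => (hfb x hx).le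
    refine hno ⟨u, hu, fun i hi => ?_⟩
    rw [huf]
    have h1 := hfa (X i) (subset_convexHull ℝ _ ⟨i, hi, rfl⟩)
    have h2 := hfb p hp
    linarith

/-- If an affine subspace misses the nonempty interior of a polytope, then some vector orthogonal
to it weakly separates it from all the vertices, and strictly from one of them. -/
lemma AffineSubspace.exists_nonneg_of_not_inter_interior_nonempty {ι : Type*}
    {F : AffineSubspace ℝ E} {p : E} (hp : p ∈ F) (X : ι → E)
    (hne : (interior (convexHull ℝ (Set.range X))).Nonempty)
    (hint : ¬ ((F : Set E) ∩ interior (convexHull ℝ (Set.range X))).Nonempty) :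
    ∃ u ∈ F.directionᗮ, (∀ i, 0 ≤ ⟪u, X i - p⟫_ℝ) ∧ ∃ j, 0 < ⟪u, X j - p⟫_ℝ := by
  rw [Set.not_nonempty_iff_eq_empty] at hint
  have hconv := convex_convexHull ℝ (Set.range X)
  obtain ⟨f, c, hfc, hcf⟩ := geometric_hahn_banach_open hconv.interior isOpen_interior F.convex
    (Set.disjoint_iff_inter_eq_empty.2 (by rwa [Set.inter_comm]))
  obtain ⟨u, hu, huf⟩ := F.exists_mem_orthogonal_of_forall_le hp hcf
  have hle : ∀ y ∈ convexHull ℝ (Set.range X), f y ≤ c := by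
    intro y hy
    have hy' : y ∈ closure (interior (convexHull ℝ (Set.range X))) := by
      rw [hconv.closure_interior_eq_closure_of_nonempty_interior hne]
      exact subset_closure hy
    exact closure_minimal (fun z hz => (hfc z hz).le)
      (isClosed_le f.continuous continuous_const) hy'
  refine ⟨u, hu, fun i => ?_, ?_⟩
  · rw [huf]
    linarith [hle (X i) (subset_convexHull ℝ _ ⟨i, rfl⟩), hcf p hp]
  · by_contra! hno
    obtain ⟨x, hx⟩ := hne
    have hsub : convexHull ℝ (Set.range X) ⊆ {y | c ≤ f y} := by
      refine convexHull_min ?_ (convex_halfSpace_ge f.toLinearMap.isLinear c)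
      rintro _ ⟨i, rfl⟩
      have h1 := hno i
      rw [huf] at h1
      have h2 := hcf p hp
      show c ≤ f (X i)
      linarith
    have h1 : c ≤ f x := hsub (interior_subset hx)
    linarith [hfc x hx]

end Separation

/-- Grouping the subsets of `Fin n` by cardinality. -/
lemma sum_neg_one_pow_mul_ncard (n : ℕ) (P : Finset (Fin n) → Prop) (hP : ¬ P ∅) :
    ∑ k ∈ Finset.Icc 1 n, (-1 : ℤ) ^ (k - 1) *
        ({I : Finset (Fin n) | I.card = k ∧ P I}.ncard : ℤ)
      = -∑ I : Finset (Fin n), (-1 : ℤ) ^ I.card * if P I then 1 else 0 := by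
  have hfiber : ∑ I : Finset (Fin n), (-1 : ℤ) ^ I.card * (if P I then 1 else 0)
      = ∑ k ∈ Finset.range (n + 1), ∑ I with I.card = k,
        (-1 : ℤ) ^ I.card * (if P I then 1 else 0) := by
    refine (Finset.sum_fiberwise_of_maps_to (fun I _ => ?_) _).symm
    exact Finset.mem_range_succ_iff.2 (card_finset_fin_le I)
  have hinner (k : ℕ) : ∑ I : Finset (Fin n) with I.card = k,
      (-1 : ℤ) ^ I.card * (if P I then 1 else 0)
        = (-1) ^ k * ({I : Finset (Fin n) | I.card = k ∧ P I}.ncard : ℤ) := by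
    have hset : {I : Finset (Fin n) | I.card = k ∧ P I} =
        ((Finset.univ.filter fun I : Finset (Fin n) => I.card = k).filter P : Set _) := by
      ext I
      simp
    rw [hset, Set.ncard_coe_finset, Finset.card_filter, Nat.cast_sum, Finset.mul_sum]
    refine Finset.sum_congr rfl fun I hI => ?_
    rw [(Finset.mem_filter.1 hI).2]
    push_cast
    rfl
  have hzero : {I : Finset (Fin n) | I.card = 0 ∧ P I} = ∅ := by
    ext I
    simp only [Finset.card_eq_zero, Set.mem_ofPred_eq, Set.mem_empty_iff_false, iff_false, not_and]
    rintro rfl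
    exact hP
  rw [hfiber]
  simp only [hinner]
  rw [Finset.sum_range_succ', hzero, Set.ncard_empty, Nat.cast_zero, mul_zero, add_zero,
    ← Finset.sum_neg_distrib, Finset.range_eq_Ico,
    Finset.sum_Ico_add' (fun k => -((-1 : ℤ) ^ k *
      ({I : Finset (Fin n) | I.card = k ∧ P I}.ncard : ℤ))) 0 n 1,
    zero_add, Finset.Ico_add_one_right_eq_Icc]
  refine Finset.sum_congr rfl fun k hk => ?_
  obtain ⟨m, rfl⟩ := Nat.exists_eq_add_of_le' (Finset.mem_Icc.1 hk).1
  rw [Nat.add_sub_cancel, pow_succ]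
  ring

/-- **Cowan's formula for affine subspaces** (Theorem 1.5). Let `X 0, …, X (n-1)` be points
in `ℝ^d` whose convex hull `Π` has dimension `d`, and let `F` be an affine subspace of `ℝ^d`.
With `c_k(F)` the number of `k`-element subcollections whose convex hull meets `F`, the
alternating sum `Σ (−1)^{k−1} c_k(F)` equals `(−1)^{d − dim F}` if `F` meets the interior of
`Π`, and `0` otherwise. -/
theorem cowan_affine (n d : ℕ) (X : Fin n → EuclideanSpace ℝ (Fin d))
    (hdim : adim (convexHull ℝ (Set.range X)) = d)
    (F : AffineSubspace ℝ (EuclideanSpace ℝ (Fin d)))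
    (hF : (F : Set (EuclideanSpace ℝ (Fin d))).Nonempty) :
    ∑ k ∈ Finset.Icc 1 n, (-1 : ℤ) ^ (k - 1) *
        ({I : Finset (Fin n) | I.card = k ∧
            ((F : Set (EuclideanSpace ℝ (Fin d))) ∩ convexHull ℝ (X '' ↑I)).Nonempty}.ncard : ℤ)
      = if ((F : Set (EuclideanSpace ℝ (Fin d)))
              ∩ interior (convexHull ℝ (Set.range X))).Nonempty
          then (-1 : ℤ) ^ (d - Module.finrank ℝ F.direction) else 0 := by
  obtain ⟨p, hp⟩ := hF
  rw [sum_neg_one_pow_mul_ncard n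
    (fun I => ((F : Set (EuclideanSpace ℝ (Fin d))) ∩ convexHull ℝ (X '' ↑I)).Nonempty) (by simp)]
  rcases Nat.eq_zero_or_pos n with rfl | hn
  · simp [Finset.univ_unique, Set.range_eq_empty, Set.eq_empty_of_isEmpty]
  set a : Fin n → EuclideanSpace ℝ (Fin d) →ₗ[ℝ] ℝ := fun i => innerₛₗ ℝ (X i - p) with ha
  have haa (i : Fin n) (u : EuclideanSpace ℝ (Fin d)) : a i u = inner ℝ u (X i - p) := by
    rw [real_inner_comm]
    rfl
  have hsum : -∑ I : Finset (Fin n), (-1 : ℤ) ^ I.card *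
      (if ((F : Set (EuclideanSpace ℝ (Fin d))) ∩ convexHull ℝ (X '' ↑I)).Nonempty then 1 else 0)
        = positiveSum a Finset.univ (F.directionᗮ : Set (EuclideanSpace ℝ (Fin d))) := by
    have halt : ∑ I : Finset (Fin n), (-1 : ℤ) ^ I.card = 0 := by
      have := Finset.sum_powerset_neg_one_pow_card_of_nonempty
        (x := (Finset.univ : Finset (Fin n))) ⟨⟨0, hn⟩, Finset.mem_univ _⟩
      rwa [Finset.powerset_univ] at this
    rw [← sub_eq_zero, positiveSum, Finset.powerset_univ, neg_sub_left, neg_eq_zero,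
      ← Finset.sum_add_distrib, ← halt]
    refine Finset.sum_congr rfl fun I _ => ?_
    simp only [AffineSubspace.inter_convexHull_image_nonempty_iff hp, haa, SetLike.mem_coe]
    split_ifs <;> simp_all
  rw [hsum]
  split_ifs with hint
  · rw [positiveSum_eq_neg_one_pow]
    · congr 1
      have := F.direction.finrank_add_finrank_orthogonal
      rw [finrank_euclideanSpace_fin] at this
      omega
    · intro u hu hle
      exact AffineSubspace.eq_zero_of_inter_interior_nonempty hp X hint hu
        fun i => haa i u ▸ hle i (Finset.mem_univ i)
  · have hspan : affineSpan ℝ (Set.range X) = ⊤ := by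
      have hdir : (affineSpan ℝ (Set.range X)).direction = ⊤ := by
        apply Submodule.eq_top_of_finrank_eq
        rw [finrank_euclideanSpace_fin, ← affineSpan_convexHull]
        exact hdim
      refine (AffineSubspace.direction_eq_top_iff_of_nonempty ?_).1 hdir
      exact ⟨X ⟨0, hn⟩, subset_affineSpan ℝ _ ⟨_, rfl⟩⟩
    obtain ⟨u, hu, hnonneg, j, hj⟩ := AffineSubspace.exists_nonneg_of_not_inter_interior_nonempty
      hp X (interior_convexHull_nonempty_iff_affineSpan_eq_top.2 hspan) hint
    exact positiveSum_eq_zero_of_nonneg a _ _ hu (fun i _ => (haa i u).symm ▸ hnonneg i)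
      (Finset.mem_univ j) ((haa j u).symm ▸ hj)
end

section
/- Let X_1,…,X_n be points in ℝ^d whose convex hull Π has dimension d, and let r ∈ {0,…,d}. Then Σ_{∅≠I⊆{1,…,n}} (−1)^{#I−1} V_r(Π_I) = (−1)^r V_r(Π), where the sum is over all non-empty subsets I of {1,…,n}. -/
open scoped Classical
open Pointwise MeasureTheory

/-- `κ m`: the volume of the `m`-dimensional unit ball. -/
noncomputable def unitBallVol (m : ℕ) : ℝ :=
  (MeasureTheory.volume (Metric.closedBall (0 : EuclideanSpace ℝ (Fin m)) 1)).toReal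

/-- `V` is the family of intrinsic volumes on compact convex subsets of `ℝ^d`, characterized
by the Steiner formula `vol_d(K + εB^d) = Σ_{j=0}^{d} ε^{d−j} κ_{d−j} V_j(K)` for `ε ≥ 0`. -/
def IsIntrinsicVolumes (d : ℕ) (V : ℕ → Set (EuclideanSpace ℝ (Fin d)) → ℝ) : Prop :=
  ∀ K : Set (EuclideanSpace ℝ (Fin d)), Convex ℝ K → IsCompact K → ∀ ε : ℝ, 0 ≤ ε →
    (MeasureTheory.volume (K + ε • Metric.closedBall (0 : EuclideanSpace ℝ (Fin d)) 1)).toReal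
      = ∑ j ∈ Finset.range (d + 1), ε ^ (d - j) * unitBallVol (d - j) * V j K

open Filter Topology in
/-- The Euler characteristic of bounded open intervals is well defined on linear relations between
indicator functions. -/
theorem sum_nonempty_eq_zero_of_real {ι : Type*} [Fintype ι] (a : ι → ℝ) (C : ι → Set ℝ)
    (ho : ∀ j, IsOpen (C j)) (hc : ∀ j, Convex ℝ (C j)) (hb : ∀ j, BddAbove (C j))
    (h : ∀ t, ∑ j, (if t ∈ C j then a j else 0) = 0) :
    ∑ j, (if (C j).Nonempty then a j else 0) = 0 := by
  have key : ∀ (c : ℝ) j, ∀ᶠ t in 𝓝[<] c, (if t ∈ C j then a j else 0) =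
      (if c ∈ C j then a j else 0) +
        (if (C j).Nonempty ∧ sSup (C j) = c then a j else 0) := by
    intro c j
    by_cases hcC : c ∈ C j
    · have hlt : sSup (C j) ≠ c := by
        intro he
        obtain ⟨y, hy, hcy⟩ := (((ho j).eventually_mem hcC).filter_mono
          (nhdsWithin_le_nhds (s := Set.Ioi c))).and self_mem_nhdsWithin |>.exists
        exact absurd (le_csSup (hb j) hy) (by rw [he]; exact not_le.2 hcy)
      filter_upwards [((ho j).eventually_mem hcC).filter_mono nhdsWithin_le_nhds] with t ht
      simp [ht, hcC, hlt]
    · by_cases hne : (C j).Nonempty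
      · rcases lt_trichotomy (sSup (C j)) c with hlt | heq | hgt
        · filter_upwards [Ioo_mem_nhdsLT hlt] with t ht
          have : t ∉ C j := fun hm => absurd (le_csSup (hb j) hm) (not_le.2 ht.1)
          simp [this, hcC, hlt.ne]
        · obtain ⟨y, hy⟩ := hne
          have hyc : y < c := lt_of_le_of_ne (heq ▸ le_csSup (hb j) hy)
            (fun e => hcC (e ▸ hy))
          filter_upwards [Ioo_mem_nhdsLT hyc] with t ht
          obtain ⟨z, hz, htz⟩ := exists_lt_of_lt_csSup ⟨y, hy⟩ (heq.symm ▸ ht.2)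
          have : t ∈ C j := (hc j).ordConnected.out hy hz ⟨ht.1.le, htz.le⟩
          simp [this, hcC, heq, Set.nonempty_of_mem hy]
        · filter_upwards [self_mem_nhdsWithin] with t ht
          have : t ∉ C j := fun hm => by
            obtain ⟨z, hz, htz⟩ := exists_lt_of_lt_csSup hne hgt
            exact hcC ((hc j).ordConnected.out hm hz ⟨le_of_lt ht, htz.le⟩)
          simp [this, hcC, hgt.ne']
      · refine Eventually.of_forall fun t => ?_
        rw [Set.not_nonempty_iff_eq_empty] at hne
        simp [hne]
  have hsum : ∀ c : ℝ, ∑ j, (if (C j).Nonempty ∧ sSup (C j) = c then a j else 0) = 0 := by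
    intro c
    obtain ⟨t, ht⟩ := (eventually_all.2 (key c)).exists
    have := Finset.sum_congr (rfl : (Finset.univ : Finset ι) = _) fun j _ => ht j
    rwa [Finset.sum_add_distrib, h, h, zero_add, eq_comm] at this
  calc ∑ j, (if (C j).Nonempty then a j else 0)
      = ∑ j, ∑ c ∈ Finset.univ.image fun j => sSup (C j),
          (if (C j).Nonempty ∧ sSup (C j) = c then a j else 0) := by
        refine Finset.sum_congr rfl fun j _ => ?_
        rw [Finset.sum_eq_single (sSup (C j))]
        · simp
        · intro b _ hb
          simp [hb.symm]
        · simp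
    _ = 0 := by
        rw [Finset.sum_comm]
        exact Finset.sum_eq_zero fun c _ => hsum c

/-- The Euler characteristic of bounded open convex sets is well defined on linear relations
between indicator functions. -/
theorem sum_nonempty_eq_zero {ι : Type*} [Fintype ι] (a : ι → ℝ) {m : ℕ}
    (C : ι → Set (Fin m → ℝ))
    (ho : ∀ j, IsOpen (C j)) (hc : ∀ j, Convex ℝ (C j))
    (hb : ∀ j, ∀ v ∈ C j, ∀ i, v i ≤ 1)
    (h : ∀ v, ∑ j, (if v ∈ C j then a j else 0) = 0) :
    ∑ j, (if (C j).Nonempty then a j else 0) = 0 := by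
  induction m with
  | zero =>
    refine Eq.trans (Finset.sum_congr rfl fun j _ => if_congr ?_ rfl rfl) (h 0)
    exact ⟨fun ⟨v, hv⟩ => Subsingleton.elim v 0 ▸ hv, fun hv => ⟨0, hv⟩⟩
  | succ m ih =>
    have htail : ∀ j, {y : Fin m → ℝ | ∃ t : ℝ, (Fin.cons t y : Fin (m + 1) → ℝ) ∈ C j} =
        Fin.tail '' C j := by
      intro j
      ext y
      constructor
      · rintro ⟨t, ht⟩
        exact ⟨_, ht, Fin.tail_cons _ _⟩
      · rintro ⟨v, hv, rfl⟩
        exact ⟨v 0, by rwa [Fin.cons_self_tail]⟩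
    have := ih (fun j => {y | ∃ t : ℝ, (Fin.cons t y : Fin (m + 1) → ℝ) ∈ C j}) ?_ ?_ ?_ ?_
    · refine Eq.trans (Finset.sum_congr rfl fun j _ => if_congr ?_ rfl rfl) this
      rw [htail, Set.image_nonempty]
    · intro j
      have : {y : Fin m → ℝ | ∃ t : ℝ, (Fin.cons t y : Fin (m + 1) → ℝ) ∈ C j} =
          ⋃ t : ℝ, (fun y => (Fin.cons t y : Fin (m + 1) → ℝ)) ⁻¹' C j := by
        ext y; simp
      rw [this]
      exact isOpen_iUnion fun t => (ho j).preimage (continuous_const.finCons continuous_id)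
    · rintro j y ⟨t, ht⟩ z ⟨s, hs⟩ α β hα hβ hαβ
      refine ⟨α • t + β • s, ?_⟩
      convert hc j ht hs hα hβ hαβ using 1
      ext i
      refine Fin.cases ?_ (fun i => ?_) i <;> simp
    · rintro j y ⟨t, ht⟩ i
      simpa using hb j _ ht i.succ
    · intro y
      refine sum_nonempty_eq_zero_of_real a
        (fun j => {t : ℝ | (Fin.cons t y : Fin (m + 1) → ℝ) ∈ C j}) ?_ ?_ ?_ ?_
      · exact fun j => (ho j).preimage (continuous_id.finCons continuous_const)
      · intro j t ht s hs α β hα hβ hαβ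
        have := hc j ht hs hα hβ hαβ
        show _ ∈ C j
        convert this using 1
        ext i
        refine Fin.cases ?_ (fun i => ?_) i
        · simp
        · simp [← add_mul, hαβ]
      · exact fun j => ⟨1, fun t ht => by simpa using hb j _ ht 0⟩
      · exact fun t => h _

theorem isOpen_forall_inner_lt {E : Type*} [NormedAddCommGroup E] [InnerProductSpace ℝ E]
    {K : Set E} (hK : IsCompact K) (x : E) :
    IsOpen {w : E | ∀ k ∈ K, inner ℝ w k < inner ℝ w x} := by
  rw [isOpen_iff_eventually]
  intro w hw
  refine hK.eventually_forall_of_forall_eventually fun k hk => ?_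
  exact (isOpen_lt (by fun_prop) (by fun_prop) : IsOpen {p : E × E | inner ℝ p.1 p.2 <
    inner ℝ p.1 x}).eventually_mem (hw k hk)

/-- A linear relation between the support functions (as point masses) of compact convex sets
is a linear relation between their indicator functions. -/
theorem sum_indicator_eq_zero {ι : Type*} [Fintype ι] {d : ℕ} (a : ι → ℝ) (ha : ∑ j, a j = 0)
    (K : ι → Set (EuclideanSpace ℝ (Fin d))) (hK : ∀ j, IsCompact (K j))
    (hc : ∀ j, Convex ℝ (K j))
    (h : ∀ (w : EuclideanSpace ℝ (Fin d)) (t : ℝ),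
      ∑ j, (if ∀ k ∈ K j, inner ℝ w k < t then a j else 0) = 0)
    (x : EuclideanSpace ℝ (Fin d)) : ∑ j, (if x ∈ K j then a j else 0) = 0 := by
  let B : Set (Fin d → ℝ) := {w | ∀ i, w i < 1}
  let D : ι → Set (EuclideanSpace ℝ (Fin d)) :=
    fun j => {w | ∀ k ∈ K j, inner ℝ w k < inner ℝ w x}
  let C : ι → Set (Fin d → ℝ) := fun j => B ∩ WithLp.toLp 2 ⁻¹' D j
  have hB : IsOpen B := by
    have : B = Set.univ.pi fun _ => Set.Iio 1 := by ext; simp [B]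
    rw [this]
    exact isOpen_set_pi Set.finite_univ fun _ _ => isOpen_Iio
  have hBc : Convex ℝ B := by
    have : B = Set.univ.pi fun _ => Set.Iio 1 := by ext; simp [B]
    rw [this]
    exact convex_pi fun _ _ => convex_Iio 1
  have hmem : ∀ j, (C j).Nonempty ↔ x ∉ K j := by
    intro j
    constructor
    · rintro ⟨w, -, hw⟩ hx
      exact lt_irrefl _ (hw x hx)
    · intro hx
      obtain ⟨f, u, hfu, hux⟩ := geometric_hahn_banach_closed_point (hc j) (hK j).isClosed hx
      obtain ⟨w, rfl⟩ := (InnerProductSpace.toDual ℝ _).surjective f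
      simp only [InnerProductSpace.toDual_apply_apply] at hfu hux
      have hlim : ∀ᶠ s : ℝ in nhdsWithin 0 (Set.Ioi 0), s • (WithLp.ofLp w) ∈ B := by
        refine Filter.Eventually.filter_mono nhdsWithin_le_nhds ?_
        refine (Continuous.tendsto (by fun_prop) 0).eventually (hB.mem_nhds ?_)
        simp [B]
      obtain ⟨s, hs, hs0⟩ := (hlim.and self_mem_nhdsWithin).exists
      refine ⟨_, hs, fun k hk => ?_⟩
      simp only [WithLp.toLp_smul, WithLp.toLp_ofLp, real_inner_smul_left]
      exact mul_lt_mul_of_pos_left ((hfu k hk).trans hux) hs0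
  have hE := sum_nonempty_eq_zero a C
    (fun j => hB.inter ((isOpen_forall_inner_lt (hK j) x).preimage (by fun_prop)))
    (fun j => hBc.inter ?_) (fun j v hv i => (hv.1 i).le) fun v => ?_
  · have := hE
    simp only [hmem] at this
    refine Eq.trans ?_ (sub_eq_zero.2 (ha.trans this.symm))
    rw [← Finset.sum_sub_distrib]
    refine Finset.sum_congr rfl fun j _ => ?_
    by_cases hx : x ∈ K j <;> simp only [hx, not_true, not_false_iff, if_true, if_false, sub_zero,
      sub_self]
  · intro v hv w hw α β hα hβ hαβ k hk
    have h1 := hv k hk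
    have h2 := hw k hk
    simp only [WithLp.toLp_add, WithLp.toLp_smul, inner_add_left, real_inner_smul_left]
    rcases hα.eq_or_lt with rfl | hα
    · have : β = 1 := by linarith
      subst this; linarith
    · nlinarith [mul_lt_mul_of_pos_left h1 hα, mul_le_mul_of_nonneg_left h2.le hβ]
  · by_cases hv : v ∈ B
    · have hvC : ∀ j, v ∈ C j ↔
          ∀ k ∈ K j, inner ℝ (WithLp.toLp 2 v) k < inner ℝ (WithLp.toLp 2 v) x :=
        fun j => ⟨fun hh => hh.2, fun hh => ⟨hv, hh⟩⟩
      simp only [hvC]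
      exact h _ _
    · exact Finset.sum_eq_zero fun j _ => if_neg fun hh => hv hh.1

theorem sum_volume_eq_zero {ι : Type*} [Fintype ι] {d : ℕ} (a : ι → ℝ) (ha : ∑ j, a j = 0)
    (K : ι → Set (EuclideanSpace ℝ (Fin d))) (hK : ∀ j, IsCompact (K j))
    (hc : ∀ j, Convex ℝ (K j))
    (h : ∀ (w : EuclideanSpace ℝ (Fin d)) (t : ℝ),
      ∑ j, (if ∀ k ∈ K j, inner ℝ w k < t then a j else 0) = 0) :
    ∑ j, a j * (volume (K j)).toReal = 0 := by
  have hint : ∀ j, Integrable ((K j).indicator fun _ => a j) :=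
    fun j => (integrable_indicator_iff (hK j).measurableSet).2
      (integrableOn_const (hK j).measure_lt_top.ne)
  calc ∑ j, a j * (volume (K j)).toReal
      = ∑ j, ∫ x, (K j).indicator (fun _ => a j) x := by
        refine Finset.sum_congr rfl fun j _ => ?_
        rw [integral_indicator_const _ (hK j).measurableSet, smul_eq_mul, mul_comm, measureReal_def]
    _ = ∫ x, ∑ j, (K j).indicator (fun _ => a j) x :=
        (integral_finsetSum _ fun j _ => hint j).symm
    _ = 0 := by
        simp only [Set.indicator_apply, sum_indicator_eq_zero a ha K hK hc h, integral_zero]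

/-- The linear functional `⟪w, ·⟫` is bounded on `K` by values it takes on `L`. -/
def DomBy {d : ℕ} (w : EuclideanSpace ℝ (Fin d)) (K L : Set (EuclideanSpace ℝ (Fin d))) : Prop :=
  ∀ k ∈ K, ∃ l ∈ L, inner ℝ w k ≤ inner ℝ w l

theorem DomBy.add_right {d : ℕ} {w : EuclideanSpace ℝ (Fin d)}
    {K L : Set (EuclideanSpace ℝ (Fin d))} (h : DomBy w K L)
    (M : Set (EuclideanSpace ℝ (Fin d))) : DomBy w (K + M) (L + M) := by
  rintro _ ⟨k, hk, m, hm, rfl⟩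
  obtain ⟨l, hl, hkl⟩ := h k hk
  exact ⟨l + m, Set.add_mem_add hl hm, by simpa [inner_add_right] using hkl⟩

theorem DomBy.of_subset {d : ℕ} {w : EuclideanSpace ℝ (Fin d)}
    {K L : Set (EuclideanSpace ℝ (Fin d))} (h : K ⊆ L) : DomBy w K L :=
  fun k hk => ⟨k, h hk, le_rfl⟩

theorem Finset.sum_eq_sum_notMem_add_insert {α M : Type*} [Fintype α] [DecidableEq α] [AddCommMonoid M]
    (i : α) (f : Finset α → M) :
    ∑ I, f I = ∑ I ∈ (Finset.univ.erase i).powerset, (f I + f (insert i I)) := by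
  rw [Finset.sum_add_distrib, ← Finset.sum_powerset_insert (Finset.notMem_erase i _),
    Finset.insert_erase (Finset.mem_univ i), Finset.powerset_univ]

theorem alternating_sum_volume_eq_zero {n d : ℕ} (hn : n ≠ 0)
    (F : Finset (Fin n) → Set (EuclideanSpace ℝ (Fin d)))
    (hF : ∀ I, IsCompact (F I)) (hc : ∀ I, Convex ℝ (F I))
    (h : ∀ w, ∃ i, ∀ I : Finset (Fin n), i ∉ I → DomBy w (F I) (F (insert i I)) ∧ DomBy w (F (insert i I)) (F I)) :
    ∑ I, (-1 : ℝ) ^ I.card * (volume (F I)).toReal = 0 := by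
  refine sum_volume_eq_zero _ ?_ F hF hc fun w t => ?_
  · have : Nonempty (Fin n) := ⟨⟨0, Nat.pos_of_ne_zero hn⟩⟩
    rw [Finset.sum_eq_sum_notMem_add_insert (Classical.arbitrary (Fin n))]
    refine Finset.sum_eq_zero fun I hI => ?_
    rw [Finset.card_insert_of_notMem fun hi => Finset.notMem_erase _ _ (Finset.mem_powerset.1 hI hi),
      pow_succ]
    ring
  · obtain ⟨i, hi⟩ := h w
    rw [Finset.sum_eq_sum_notMem_add_insert i]
    refine Finset.sum_eq_zero fun I hI => ?_
    have hiI : i ∉ I := fun hi => Finset.notMem_erase _ _ (Finset.mem_powerset.1 hI hi)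
    have hiff : (∀ k ∈ F (insert i I), inner ℝ w k < t) ↔ ∀ k ∈ F I, inner ℝ w k < t := by
      constructor
      · intro hk k hkI
        obtain ⟨l, hl, hkl⟩ := (hi I hiI).1 k hkI
        exact hkl.trans_lt (hk l hl)
      · intro hk k hkI
        obtain ⟨l, hl, hkl⟩ := (hi I hiI).2 k hkI
        exact hkl.trans_lt (hk l hl)
    simp only [hiff]
    rw [Finset.card_insert_of_notMem hiI, pow_succ]
    split_ifs <;> ring

theorem DomBy.add_left {d : ℕ} {w : EuclideanSpace ℝ (Fin d)}
    {K L : Set (EuclideanSpace ℝ (Fin d))} (h : DomBy w K L)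
    (M : Set (EuclideanSpace ℝ (Fin d))) : DomBy w (M + K) (M + L) := by
  simpa only [add_comm M] using h.add_right M

theorem domBy_convexHull_singleton {d : ℕ} {w y : EuclideanSpace ℝ (Fin d)}
    {S : Set (EuclideanSpace ℝ (Fin d))} (h : ∀ s ∈ S, inner ℝ w s ≤ inner ℝ w y) :
    DomBy w (convexHull ℝ S) {y} := by
  intro k hk
  refine ⟨y, rfl, ?_⟩
  have hconv : Convex ℝ {z : EuclideanSpace ℝ (Fin d) | inner ℝ w z ≤ inner ℝ w y} :=
    convex_halfSpace_le (innerₛₗ ℝ w).isLinear _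
  exact convexHull_min h hconv hk

theorem domBy_singleton_convexHull {d : ℕ} {w y : EuclideanSpace ℝ (Fin d)}
    {S : Set (EuclideanSpace ℝ (Fin d))} (h : y ∈ S) : DomBy w {y} (convexHull ℝ S) :=
  DomBy.of_subset (Set.singleton_subset_iff.2 (subset_convexHull ℝ S h))

theorem alternating_sum_volume_add_smul {n d : ℕ} (hn : n ≠ 0)
    (Y : Fin n → EuclideanSpace ℝ (Fin d)) {N : Set (EuclideanSpace ℝ (Fin d))}
    (hN : IsCompact N) (hNc : Convex ℝ N) :
    ∑ J : Finset (Fin n), (-1 : ℝ) ^ J.card *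
      (volume (N + (J.card : ℝ) • convexHull ℝ (Set.range Y))).toReal = 0 := by
  have : Nonempty (Fin n) := ⟨⟨0, Nat.pos_of_ne_zero hn⟩⟩
  set Q := convexHull ℝ (Set.range Y) with hQ
  have hQc : Convex ℝ Q := convex_convexHull ℝ _
  have hQk : IsCompact Q := (Set.finite_range Y).isCompact_convexHull (𝕜 := ℝ)
  have key := alternating_sum_volume_eq_zero hn
    (fun J => {∑ j ∈ Jᶜ, Y j} + (N + (J.card : ℝ) • Q))
    (fun J => isCompact_singleton.add (hN.add (hQk.smul _)))
    (fun J => (convex_singleton _).add (hNc.add (hQc.smul _))) ?_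
  · rw [← key]
    refine Finset.sum_congr rfl fun J _ => ?_
    rw [Set.singleton_add, Set.image_add_left, measure_preimage_add]
  · intro w
    obtain ⟨i, hi⟩ := Finite.exists_max fun i => inner ℝ w (Y i)
    refine ⟨i, fun J hiJ => ?_⟩
    have h1 : ({∑ j ∈ Jᶜ, Y j} : Set (EuclideanSpace ℝ (Fin d))) + (N + (J.card : ℝ) • Q) =
        {∑ j ∈ (insert i J)ᶜ, Y j} + (N + (J.card : ℝ) • Q) + {Y i} := by
      rw [add_right_comm, Set.singleton_add_singleton, Finset.compl_insert,
        Finset.sum_erase_add _ _ (Finset.mem_compl.2 hiJ)]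
    have h2 : ({∑ j ∈ (insert i J)ᶜ, Y j} : Set (EuclideanSpace ℝ (Fin d))) +
        (N + ((insert i J).card : ℝ) • Q) =
        {∑ j ∈ (insert i J)ᶜ, Y j} + (N + (J.card : ℝ) • Q) + Q := by
      rw [Finset.card_insert_of_notMem hiJ, Nat.cast_add_one,
        hQc.add_smul (Nat.cast_nonneg _) zero_le_one, one_smul]
      simp only [add_assoc]
    rw [h1, h2]
    exact ⟨(domBy_singleton_convexHull (Set.mem_range_self i)).add_left _,
      (domBy_convexHull_singleton (Set.forall_mem_range.2 hi)).add_left _⟩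

theorem fwdDiff_iter_volume_add_smul {n d : ℕ} (hn : n ≠ 0)
    (Y : Fin n → EuclideanSpace ℝ (Fin d)) {N : Set (EuclideanSpace ℝ (Fin d))}
    (hN : IsCompact N) (hNc : Convex ℝ N) :
    (fwdDiff 1)^[n] (fun s : ℕ => (volume (N + (s : ℝ) • convexHull ℝ (Set.range Y))).toReal) =
      0 := by
  ext y
  have hQc : Convex ℝ (convexHull ℝ (Set.range Y)) := convex_convexHull ℝ _
  have hQk : IsCompact (convexHull ℝ (Set.range Y)) := (Set.finite_range Y).isCompact_convexHull (𝕜 := ℝ)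
  have key := alternating_sum_volume_add_smul hn Y (hN.add (hQk.smul (y : ℝ)))
    (hNc.add (hQc.smul (y : ℝ)))
  rw [← Finset.powerset_univ, Finset.sum_powerset_apply_card (fun k => (-1 : ℝ) ^ k *
    (volume (N + (y : ℝ) • convexHull ℝ (Set.range Y) +
      (k : ℝ) • convexHull ℝ (Set.range Y))).toReal), Finset.card_univ, Fintype.card_fin] at key
  rw [fwdDiff_iter_eq_sum_shift, Pi.zero_apply, ← mul_zero ((-1 : ℝ) ^ n), ← key, Finset.mul_sum]
  refine Finset.sum_congr rfl fun k hk => ?_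
  have hkn : k ≤ n := Nat.lt_succ_iff.1 (Finset.mem_range.1 hk)
  have hsign : (-1 : ℝ) ^ n * (-1) ^ k = (-1) ^ (n - k) := by
    obtain ⟨m, rfl⟩ := Nat.exists_eq_add_of_le hkn
    rw [Nat.add_sub_cancel_left, pow_add, mul_right_comm, ← mul_pow]
    simp
  rw [add_assoc N, ← hQc.add_smul (Nat.cast_nonneg _) (Nat.cast_nonneg _)]
  simp only [zsmul_eq_mul, nsmul_eq_mul, smul_eq_mul, mul_one]
  push_cast
  rw [← hsign]
  ring

theorem alternating_sum_volume_hull_sub {n d : ℕ} (hn : n ≠ 0)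
    (X : Fin n → EuclideanSpace ℝ (Fin d)) {N : Set (EuclideanSpace ℝ (Fin d))}
    (hN : IsCompact N) (hNc : Convex ℝ N) :
    ∑ I : Finset (Fin n) with I.Nonempty, (-1 : ℝ) ^ (I.card - 1) *
      (volume (convexHull ℝ (X '' I) + (convexHull ℝ (Set.range (-X)) + N))).toReal =
    (volume N).toReal := by
  have : Nonempty (Fin n) := ⟨⟨0, Nat.pos_of_ne_zero hn⟩⟩
  set Q := convexHull ℝ (Set.range (-X)) with hQ
  have hQc : Convex ℝ Q := convex_convexHull ℝ _
  have hQk : IsCompact Q := (Set.finite_range (-X)).isCompact_convexHull (𝕜 := ℝ)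
  have key := alternating_sum_volume_eq_zero hn
    (fun I => if I.Nonempty then convexHull ℝ (X '' I) + (Q + N) else N) ?_ ?_ ?_
  · rw [← Finset.sum_filter_add_sum_filter_not _ (fun I : Finset (Fin n) => I.Nonempty)] at key
    have hempty : (Finset.univ.filter fun I : Finset (Fin n) => ¬ I.Nonempty) = {∅} := by
      ext I; simp
    rw [hempty, Finset.sum_singleton] at key
    simp only [Finset.card_empty, pow_zero, one_mul, Finset.not_nonempty_empty, if_false] at key
    rw [eq_comm, ← sub_eq_zero, ← key, sub_eq_add_neg, add_comm, ← Finset.sum_neg_distrib]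
    congr 1
    refine Finset.sum_congr rfl fun I hI => ?_
    have hI := (Finset.mem_filter.1 hI).2
    obtain ⟨m, hm⟩ := Nat.exists_eq_succ_of_ne_zero hI.card_pos.ne'
    rw [if_pos hI, hm, Nat.succ_sub_one, pow_succ]
    ring
  · intro I
    beta_reduce
    split_ifs
    · exact (I.finite_toSet.image X).isCompact_convexHull (𝕜 := ℝ).add (hQk.add hN)
    · exact hN
  · intro I
    beta_reduce
    split_ifs
    · exact (convex_convexHull ℝ _).add (hQc.add hNc)
    · exact hNc
  · intro w
    obtain ⟨i, hi⟩ := Finite.exists_min fun i => inner ℝ w (X i)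
    refine ⟨i, fun I hiI => ?_⟩
    simp only [Finset.insert_nonempty, if_true]
    rcases I.eq_empty_or_nonempty with rfl | hI
    · simp only [Finset.not_nonempty_empty, if_false, insert_empty_eq, Finset.coe_singleton,
        Set.image_singleton, convexHull_singleton]
      have h0 : N = {X i} + ({-X i} + N) := by
        rw [← add_assoc, Set.singleton_add_singleton, add_neg_cancel, Set.singleton_zero, zero_add]
      have hQ1 : DomBy w {-X i} Q := domBy_singleton_convexHull ⟨i, rfl⟩
      have hQ2 : DomBy w Q {-X i} :=
        domBy_convexHull_singleton (Set.forall_mem_range.2 fun j => by simpa using hi j)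
      constructor
      · nth_rewrite 1 [h0]
        exact (hQ1.add_right N).add_left _
      · nth_rewrite 2 [h0]
        exact (hQ2.add_right N).add_left _
    · simp only [hI, if_true]
      constructor
      · exact DomBy.add_right (DomBy.of_subset (convexHull_mono (Set.image_mono
          (Finset.coe_subset.2 (Finset.subset_insert i I))))) _
      · refine DomBy.add_right ?_ _
        obtain ⟨m, hm, hmax⟩ := I.exists_max_image (fun j => inner ℝ w (X j)) hI
        have h1 : DomBy w (convexHull ℝ (X '' ↑(insert i I))) {X m} := by
          refine domBy_convexHull_singleton ?_
          rintro _ ⟨j, hj, rfl⟩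
          rcases Finset.mem_insert.1 (Finset.mem_coe.1 hj) with rfl | hj
          · exact hi m
          · exact hmax j hj
        intro k hk
        obtain ⟨_, rfl, hl⟩ := h1 k hk
        exact ⟨X m, subset_convexHull ℝ _ ⟨m, hm, rfl⟩, hl⟩

theorem eq_zero_of_fwdDiff_iter_eq_zero {m N : ℕ} {f : ℕ → ℝ} (h0 : ∀ s ≥ N, f s = 0)
    (h : (fwdDiff 1)^[m] f = 0) : f = 0 := by
  induction m generalizing f with
  | zero => exact h
  | succ m ih =>
    have hd : fwdDiff 1 f = 0 :=
      ih (fun s hs => by simp [fwdDiff, h0 s hs, h0 (s + 1) (by omega)]) h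
    have hconst : ∀ s, f s = f 0 := by
      intro s
      induction s with
      | zero => rfl
      | succ s ihs => rw [← ihs]; exact sub_eq_zero.1 (congrFun hd s)
    ext s
    rw [hconst s, ← hconst N, h0 N le_rfl, Pi.zero_apply]

theorem fwdDiff_iter_eval_natCast (p : Polynomial ℝ) :
    (fwdDiff 1)^[p.natDegree + 1] (fun s : ℕ => p.eval (s : ℝ)) = 0 := by
  ext y
  have := congrFun p.fwdDiff_iter_degree_add_one_eq_zero (y : ℝ)
  rw [fwdDiff_iter_eq_sum_shift] at this ⊢
  simpa using this

theorem coeff_eq_zero_of_sum_pow_eq_zero {d : ℕ} {c : ℕ → ℝ}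
    (h : ∀ ε : ℝ, 0 ≤ ε → ∑ j ∈ Finset.range (d + 1), ε ^ (d - j) * c j = 0) {r : ℕ}
    (hr : r ≤ d) : c r = 0 := by
  let p : Polynomial ℝ := ∑ j ∈ Finset.range (d + 1), Polynomial.monomial (d - j) (c j)
  have hp : p = 0 := by
    refine p.eq_zero_of_infinite_isRoot ((Set.Ici_infinite (0 : ℝ)).mono fun ε hε => ?_)
    simp only [Set.mem_ofPred_eq, Polynomial.IsRoot.def, p, Polynomial.eval_finsetSum,
      Polynomial.eval_monomial]
    simpa only [mul_comm] using h ε hε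
  have hcoeff : p.coeff (d - r) = c r := by
    simp only [p, Polynomial.finsetSum_coeff, Polynomial.coeff_monomial]
    rw [Finset.sum_eq_single r]
    · simp
    · intro j hj hjr
      rw [if_neg]
      have := Finset.mem_range.1 hj
      omega
    · intro hr'
      exact absurd (Finset.mem_range.2 (Nat.lt_succ_iff.2 hr)) hr'
  rw [← hcoeff, hp, Polynomial.coeff_zero]

theorem volume_add_smul_neg_hull {d : ℕ} {P : Set (EuclideanSpace ℝ (Fin d))} {ε s : ℝ}
    (hs : 0 < s) :
    (volume (ε • Metric.closedBall (0 : EuclideanSpace ℝ (Fin d)) 1 + s • (-P))).toReal =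
      s ^ d *
        (volume (P + (ε / s) • Metric.closedBall (0 : EuclideanSpace ℝ (Fin d)) 1)).toReal := by
  have hset : ε • Metric.closedBall (0 : EuclideanSpace ℝ (Fin d)) 1 + s • (-P) =
      (-s) • (P + (ε / s) • Metric.closedBall (0 : EuclideanSpace ℝ (Fin d)) 1) := by
    have hball : -Metric.closedBall (0 : EuclideanSpace ℝ (Fin d)) 1 = Metric.closedBall 0 1 := by
      rw [neg_closedBall, neg_zero]
    rw [smul_add, smul_smul, neg_mul, mul_div_cancel₀ _ hs.ne', Set.neg_smul_set, Set.neg_smul_set,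
      ← Set.smul_set_neg, ← Set.smul_set_neg, hball, add_comm]
  rw [hset, Measure.addHaar_smul, ENNReal.toReal_mul, finrank_euclideanSpace_fin, abs_pow, abs_neg,
    abs_of_pos hs, ENNReal.toReal_ofReal (by positivity)]

open Polynomial in
theorem alternating_sum_steiner {n d : ℕ} (hn : n ≠ 0) (X : Fin n → EuclideanSpace ℝ (Fin d))
    {V : ℕ → Set (EuclideanSpace ℝ (Fin d)) → ℝ} (hV : IsIntrinsicVolumes d V) {ε : ℝ}
    (hε : 0 ≤ ε) :
    ∑ I : Finset (Fin n) with I.Nonempty, (-1 : ℝ) ^ (I.card - 1) *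
      (volume (convexHull ℝ (X '' I) +
        ε • Metric.closedBall (0 : EuclideanSpace ℝ (Fin d)) 1)).toReal =
    ∑ j ∈ Finset.range (d + 1),
      ε ^ (d - j) * unitBallVol (d - j) * V j (convexHull ℝ (Set.range X)) * (-1) ^ j := by
  have : Nonempty (Fin n) := ⟨⟨0, Nat.pos_of_ne_zero hn⟩⟩
  set P := convexHull ℝ (Set.range X) with hP
  set Q := convexHull ℝ (Set.range (-X)) with hQ
  set B := ε • Metric.closedBall (0 : EuclideanSpace ℝ (Fin d)) 1 with hB
  have hPc : Convex ℝ P := convex_convexHull ℝ _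
  have hPk : IsCompact P := (Set.finite_range X).isCompact_convexHull (𝕜 := ℝ)
  have hQc : Convex ℝ Q := convex_convexHull ℝ _
  have hQk : IsCompact Q := (Set.finite_range (-X)).isCompact_convexHull (𝕜 := ℝ)
  have hBc : Convex ℝ B := (convex_closedBall _ _).smul _
  have hBk : IsCompact B := (isCompact_closedBall _ _).smul _
  have hQP : Q = -P := by
    rw [hP, hQ, ← convexHull_neg]
    congr 1
    ext v
    simp [neg_eq_iff_eq_neg]
  let g : ℕ → ℝ := ∑ I : Finset (Fin n) with I.Nonempty, (-1 : ℝ) ^ (I.card - 1) •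
    fun s : ℕ => (volume (convexHull ℝ (X '' I) + B + (s : ℝ) • Q)).toReal
  have hg : ∀ s, g s = ∑ I : Finset (Fin n) with I.Nonempty, (-1 : ℝ) ^ (I.card - 1) *
      (volume (convexHull ℝ (X '' I) + B + (s : ℝ) • Q)).toReal := by
    intro s
    simp [g, Finset.sum_apply]
  let c : ℕ → ℝ := fun j => ε ^ (d - j) * unitBallVol (d - j) * V j P
  let p : ℝ[X] := ∑ j ∈ Finset.range (d + 1), C (c j) * (Polynomial.X - C 1) ^ j
  have hp : ∀ x, p.eval x = ∑ j ∈ Finset.range (d + 1), c j * (x - 1) ^ j := by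
    intro x
    simp [p, eval_finsetSum]
  have hgdiff : (fwdDiff 1)^[n] g = 0 := by
    rw [fwdDiff_iter_finsetSum]
    refine Finset.sum_eq_zero fun I _ => ?_
    rw [fwdDiff_iter_const_smul, fwdDiff_iter_volume_add_smul hn (-X)
      (((I.finite_toSet.image X).isCompact_convexHull (𝕜 := ℝ)).add hBk)
      ((convex_convexHull ℝ _).add hBc), smul_zero]
  have hshift : ∀ s : ℕ, g (s + 1) = (volume (B + (s : ℝ) • Q)).toReal := by
    intro s
    rw [hg, ← alternating_sum_volume_hull_sub hn X (hBk.add (hQk.smul (s : ℝ)))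
      (hBc.add (hQc.smul (s : ℝ)))]
    refine Finset.sum_congr rfl fun I _ => ?_
    rw [Nat.cast_add_one, hQc.add_smul (Nat.cast_nonneg _) zero_le_one, one_smul, add_assoc,
      add_left_comm Q B, add_comm Q]
  have hgp : ∀ s ≥ 2, g s = p.eval (s : ℝ) := by
    intro s hs
    obtain ⟨s, rfl⟩ := Nat.exists_eq_add_of_le' hs
    have hpos : (0 : ℝ) < (s + 1 : ℕ) := by positivity
    rw [show s + 2 = s + 1 + 1 from rfl, hshift, hQP, volume_add_smul_neg_hull hpos,
      hV P hPc hPk _ (div_nonneg hε hpos.le), hp, Finset.mul_sum]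
    refine Finset.sum_congr rfl fun j hj => ?_
    have hjd : j ≤ d := Nat.lt_succ_iff.1 (Finset.mem_range.1 hj)
    obtain ⟨k, rfl⟩ := Nat.exists_eq_add_of_le hjd
    simp only [c, Nat.add_sub_cancel_left]
    rw [Nat.cast_add_one (s + 1), add_sub_cancel_right, div_pow, pow_add]
    field_simp
  have hzero : g + (-1 : ℝ) • (fun s : ℕ => p.eval (s : ℝ)) = 0 := by
    refine eq_zero_of_fwdDiff_iter_eq_zero (m := n + (p.natDegree + 1)) (N := 2) ?_ ?_
    · intro s hs
      simp [hgp s hs]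
    · have hconst : ∀ m, (fwdDiff (1 : ℕ))^[m] (0 : ℕ → ℝ) = 0 := fun m => by
        simpa using fwdDiff_iter_const_smul (1 : ℕ) (0 : ℝ) (0 : ℕ → ℝ) m
      rw [fwdDiff_iter_add, fwdDiff_iter_const_smul, add_comm n, Function.iterate_add_apply, hgdiff,
        hconst, add_comm _ n, Function.iterate_add_apply, fwdDiff_iter_eval_natCast, hconst]
      simp
  have h0 : g 0 = p.eval 0 := by
    have := congrFun hzero 0
    simp only [Pi.add_apply, Pi.smul_apply, Nat.cast_zero, Pi.zero_apply, smul_eq_mul] at this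
    linarith
  have hQne : Q.Nonempty := (Set.range_nonempty _).convexHull
  rw [hg, hp] at h0
  simpa only [Nat.cast_zero, Set.zero_smul_set hQne, add_zero, zero_sub, c] using h0

theorem unitBallVol_pos (m : ℕ) : 0 < unitBallVol m :=
  ENNReal.toReal_pos (Metric.measure_closedBall_pos _ _ one_pos).ne'
    (isCompact_closedBall _ _).measure_lt_top.ne

theorem IsIntrinsicVolumes.apply_empty {d : ℕ} {V : ℕ → Set (EuclideanSpace ℝ (Fin d)) → ℝ}
    (hV : IsIntrinsicVolumes d V) {r : ℕ} (hr : r ≤ d) : V r ∅ = 0 := by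
  have := coeff_eq_zero_of_sum_pow_eq_zero (c := fun j => unitBallVol (d - j) * V j ∅)
    (fun ε hε => by simpa [mul_assoc] using (hV ∅ convex_empty isCompact_empty ε hε).symm) hr
  exact (mul_eq_zero.1 this).resolve_left (unitBallVol_pos _).ne'

/-- **Inclusion–exclusion for intrinsic volumes** (Theorem 1.6). For points `X 0, …, X (n-1)`
in `ℝ^d` with `dim Π = d` and `0 ≤ r ≤ d`,
`Σ_{∅≠I⊆{1,…,n}} (−1)^{#I−1} V_r(Π_I) = (−1)^r V_r(Π)`. -/
theorem cowan_intrinsic_volumes (n d r : ℕ) (hr : r ≤ d)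
    (X : Fin n → EuclideanSpace ℝ (Fin d))
    (hdim : adim (convexHull ℝ (Set.range X)) = d)
    (V : ℕ → Set (EuclideanSpace ℝ (Fin d)) → ℝ) (hV : IsIntrinsicVolumes d V) :
    ∑ I ∈ Finset.univ.powerset.filter (fun I : Finset (Fin n) => I.Nonempty),
        (-1 : ℝ) ^ (I.card - 1) * V r (convexHull ℝ (X '' ↑I))
      = (-1 : ℝ) ^ r * V r (convexHull ℝ (Set.range X)) := by
  rw [Finset.powerset_univ]
  rcases Nat.eq_zero_or_pos n with rfl | hn
  · have hempty : Finset.univ.filter (fun I : Finset (Fin 0) => I.Nonempty) = ∅ := by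
      ext I
      simp [Finset.eq_empty_of_isEmpty I]
    rw [hempty, Finset.sum_empty, Set.range_eq_empty, convexHull_empty, hV.apply_empty hr, mul_zero]
  · have hcoeff := coeff_eq_zero_of_sum_pow_eq_zero (d := d) (c := fun j => unitBallVol (d - j) *
      (∑ I : Finset (Fin n) with I.Nonempty,
        (-1 : ℝ) ^ (I.card - 1) * V j (convexHull ℝ (X '' I)) -
        (-1 : ℝ) ^ j * V j (convexHull ℝ (Set.range X)))) (fun ε hε => ?_) hr
    · exact sub_eq_zero.1 ((mul_eq_zero.1 hcoeff).resolve_left (unitBallVol_pos _).ne')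
    · have h := alternating_sum_steiner hn.ne' X hV hε
      rw [Finset.sum_congr rfl fun I _ => by
        rw [hV _ (convex_convexHull ℝ _)
          ((I.finite_toSet.image X).isCompact_convexHull (𝕜 := ℝ)) ε hε, Finset.mul_sum],
        Finset.sum_comm, ← sub_eq_zero, ← Finset.sum_sub_distrib] at h
      rw [← h]
      refine Finset.sum_congr rfl fun j _ => ?_
      rw [mul_sub, mul_sub, Finset.mul_sum, Finset.mul_sum]
      congr 1
      · exact Finset.sum_congr rfl fun I _ => by ring
      · ring
end

section
/- Let (X_1,…,X_n) be an exchangeable tuple of random vectors in ℝ^d such that almost surely dim conv(X_1,…,X_n) = d. Fix r ∈ {0,…,d} and assume E V_r(Π) < ∞, where Π = conv(X_1,…,X_n). With v_r(k) := E V_r(conv(X_1,…,X_k)) for k = 1,…,n, one has Σ_{k=1}^{n} (−1)^{k−1} (n choose k) v_r(k) = (−1)^r v_r(n). -/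
open scoped Classical
open Pointwise MeasureTheory

theorem eventually_mem_iff_right {I : Set ℝ} (ho : IsOpen I) (hc : Convex ℝ I) (α : ℝ) :
    ∀ᶠ t in nhdsWithin α (Set.Ioi α),
      (t ∈ I ↔ α ∈ I ∨ (I.Nonempty ∧ BddBelow I ∧ sInf I = α)) := by
  have hoc := hc.ordConnected
  by_cases hα : α ∈ I
  · filter_upwards [nhdsWithin_le_nhds (ho.mem_nhds hα)] with t ht
    simp [ht, hα]
  · by_cases hI : I.Nonempty ∧ BddBelow I ∧ sInf I = α
    · obtain ⟨⟨x, hx⟩, hb, rfl⟩ := hI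
      have hlt : sInf I < x := lt_of_le_of_ne (csInf_le hb hx) fun h => hα (h ▸ hx)
      filter_upwards [Ioo_mem_nhdsGT hlt] with t ht
      obtain ⟨y, hy, hyt⟩ := exists_lt_of_csInf_lt ⟨x, hx⟩ ht.1
      have : t ∈ I := hoc.out hy hx ⟨hyt.le, ht.2.le⟩
      exact iff_of_true this (Or.inr ⟨⟨x, hx⟩, hb, rfl⟩)
    · simp only [hα, hI, or_self, iff_false]
      by_cases hx : ∃ x ∈ I, x < α
      · obtain ⟨x, hx, hxα⟩ := hx
        filter_upwards [self_mem_nhdsWithin] with t ht hI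
        exact hα (hoc.out hx hI ⟨hxα.le, le_of_lt ht⟩)
      · push Not at hx
        by_cases hne : I.Nonempty
        · have hb : BddBelow I := ⟨α, hx⟩
          have hlt : α < sInf I := lt_of_le_of_ne (le_csInf hne hx) fun h => hI ⟨hne, hb, h.symm⟩
          filter_upwards [Ioo_mem_nhdsGT hlt] with t ht htI
          exact absurd (csInf_le hb htI) (not_le.2 ht.2)
        · exact Filter.Eventually.of_forall fun t ht => hne ⟨t, ht⟩

theorem IsOpen.sInf_notMem_real {I : Set ℝ} (ho : IsOpen I) (hb : BddBelow I) : sInf I ∉ I := by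
  intro h
  obtain ⟨l, hl, hlI⟩ := exists_Ioc_subset_of_mem_nhds (ho.mem_nhds h) ⟨_, sub_one_lt _⟩
  obtain ⟨y, hy⟩ := exists_between hl
  exact absurd (csInf_le hb (hlI ⟨hy.1, hy.2.le⟩)) (not_le.2 hy.2)

theorem eventually_mem_iff_atBot {I : Set ℝ} (hc : Convex ℝ I) :
    ∀ᶠ t in Filter.atBot, (t ∈ I ↔ I.Nonempty ∧ ¬ BddBelow I) := by
  by_cases h : I.Nonempty ∧ ¬ BddBelow I
  · obtain ⟨⟨x, hx⟩, hb⟩ := h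
    filter_upwards [Filter.eventually_le_atBot x] with t ht
    obtain ⟨y, hy, hyt⟩ := not_bddBelow_iff.1 hb t
    have : t ∈ I := hc.ordConnected.out hy hx ⟨hyt.le, ht⟩
    simp only [this, true_iff]
    exact ⟨⟨x, hx⟩, hb⟩
  · by_cases hb : BddBelow I
    · obtain ⟨m, hm⟩ := hb
      filter_upwards [Filter.eventually_lt_atBot m] with t ht
      simp only [h, iff_false]
      exact fun htI => absurd (hm htI) (not_le.2 ht)
    · refine Filter.Eventually.of_forall fun t => ?_
      simp only [h, iff_false]
      exact fun htI => h ⟨⟨t, htI⟩, hb⟩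

/-- If a linear combination of indicators of open intervals is a multiple of the indicator of the
origin, then its Euler characteristic is minus that multiple. -/
theorem euler_real {ι : Type*} [Fintype ι] (a : ι → ℝ) (I : ι → Set ℝ)
    (ho : ∀ j, IsOpen (I j)) (hc : ∀ j, Convex ℝ (I j)) (c : ℝ)
    (h : ∀ t, ∑ j, (if t ∈ I j then a j else 0) = if t = 0 then c else 0) :
    ∑ j, (if (I j).Nonempty then a j else 0) = -c := by
  have hbot : ∑ j, (if (I j).Nonempty ∧ ¬ BddBelow (I j) then a j else 0) = 0 := by
    obtain ⟨t, ht, ht0⟩ := ((Filter.eventually_all.2 fun j => eventually_mem_iff_atBot (hc j)).and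
      (Filter.eventually_lt_atBot (0 : ℝ))).exists
    simp only [← ht, h, ht0.ne, if_false]
  have hjump : ∀ α, ∑ j, (if (I j).Nonempty ∧ BddBelow (I j) ∧ sInf (I j) = α then a j else 0)
      = if α = 0 then -c else 0 := by
    intro α
    have hne : ∀ᶠ t in nhdsWithin α (Set.Ioi α), t ≠ 0 := by
      rcases lt_or_ge α 0 with h0 | h0
      · filter_upwards [Ioo_mem_nhdsGT h0] with t ht using ht.2.ne
      · filter_upwards [self_mem_nhdsWithin] with t ht using (h0.trans_lt ht).ne'
    obtain ⟨t, ht, ht0⟩ := ((Filter.eventually_all.2 fun j =>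
      eventually_mem_iff_right (ho j) (hc j) α).and hne).exists
    have h1 := h t
    have h2 := h α
    rw [if_neg ht0] at h1
    have : ∀ j, (if (I j).Nonempty ∧ BddBelow (I j) ∧ sInf (I j) = α then a j else 0)
        = (if t ∈ I j then a j else 0) - (if α ∈ I j then a j else 0) := by
      intro j
      have hd : (I j).Nonempty ∧ BddBelow (I j) ∧ sInf (I j) = α → α ∉ I j :=
        fun hj => hj.2.2 ▸ (ho j).sInf_notMem_real hj.2.1
      have := ht j
      by_cases h1 : α ∈ I j <;>
        by_cases h2 : (I j).Nonempty ∧ BddBelow (I j) ∧ sInf (I j) = α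
      · exact absurd h1 (hd h2)
      · rw [if_neg h2, if_pos (this.2 (Or.inl h1)), if_pos h1, sub_self]
      · rw [if_pos h2, if_pos (this.2 (Or.inr h2)), if_neg h1, sub_zero]
      · rw [if_neg h2, if_neg (fun h => (this.1 h).elim h1 h2), if_neg h1, sub_zero]
    simp only [this, Finset.sum_sub_distrib, h1, h2]
    split_ifs <;> simp
  set S : Finset ℝ := insert 0 (Finset.univ.image fun j => sInf (I j)) with hS
  have hsplit : ∀ j, (if (I j).Nonempty then a j else 0)
      = (if (I j).Nonempty ∧ ¬ BddBelow (I j) then a j else 0)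
        + ∑ α ∈ S, (if (I j).Nonempty ∧ BddBelow (I j) ∧ sInf (I j) = α then a j else 0) := by
    intro j
    have hmem : sInf (I j) ∈ S := by simp [hS]
    by_cases h1 : (I j).Nonempty <;> by_cases h2 : BddBelow (I j) <;> simp [h1, h2, hmem]
  simp only [hsplit, Finset.sum_add_distrib, hbot]
  rw [Finset.sum_comm]
  simp only [hjump]
  simp [hS]

theorem euler_relation {ι : Type*} [Fintype ι] (a : ι → ℝ) (p : ℕ) :
    ∀ (O : ι → Set (Fin p → ℝ)), (∀ j, IsOpen (O j)) → (∀ j, Convex ℝ (O j)) → ∀ c : ℝ,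
    (∀ x, ∑ j, (if x ∈ O j then a j else 0) = if x = 0 then c else 0) →
    ∑ j, (if (O j).Nonempty then a j else 0) = (-1) ^ p * c := by
  induction p with
  | zero =>
    intro O ho hc c h
    have := h 0
    simp only [if_true] at this
    simp only [pow_zero, one_mul, ← this]
    refine Finset.sum_congr rfl fun j _ => ?_
    have : (O j).Nonempty ↔ 0 ∈ O j :=
      ⟨fun ⟨x, hx⟩ => by rwa [Subsingleton.elim 0 x], fun h => ⟨0, h⟩⟩
    simp only [this]
  | succ p ih =>
    intro O ho hc c h
    let ev : (Fin (p + 1) → ℝ) →L[ℝ] ℝ := ContinuousLinearMap.proj 0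
    have hev : IsOpenMap ev := ev.isOpenMap (fun t => ⟨fun _ => t, rfl⟩)
    have key := euler_real a (fun j => ev '' O j) (fun j => hev _ (ho j))
      (fun j => (hc j).linear_image ev.toLinearMap) ((-1) ^ p * c) ?_
    · simp only [Set.image_nonempty] at key
      rw [key]; ring
    · intro t
      have := ih (fun j => {x | Fin.cons t x ∈ O j}) (fun j => ?_) (fun j => ?_)
        (if t = 0 then c else 0) (fun x => ?_)
      · rw [show (if t = 0 then (-1) ^ p * c else 0) = (-1) ^ p * (if t = 0 then c else 0) by
          split_ifs <;> simp, ← this]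
        refine Finset.sum_congr rfl fun j _ => ?_
        congr 1
        apply propext
        constructor
        · rintro ⟨x, hx, rfl⟩
          exact ⟨Fin.tail x, by simpa [ev] using hx⟩
        · rintro ⟨x, hx⟩
          exact ⟨_, hx, by simp [ev]⟩
      · have : Continuous fun x : Fin p → ℝ => (Fin.cons t x : Fin (p + 1) → ℝ) := by
          refine continuous_pi fun i => ?_
          refine Fin.cases ?_ (fun i => ?_) i
          · simpa using continuous_const
          · simpa using continuous_apply i
        exact (ho j).preimage this
      · intro x hx y hy α β hα hβ hαβ
        have := hc j hx hy hα hβ hαβ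
        have e : α • (Fin.cons t x : Fin (p + 1) → ℝ) + β • (Fin.cons t y : Fin (p + 1) → ℝ)
            = Fin.cons t (α • x + β • y) := by
          ext i
          refine Fin.cases ?_ (fun i => ?_) i
          · simp [← add_mul, hαβ]
          · simp
        rwa [e] at this
      · simp only [Set.mem_ofPred_eq]
        rw [h]
        have : (Fin.cons t x : Fin (p + 1) → ℝ) = 0 ↔ t = 0 ∧ x = 0 := by
          simp [funext_iff, Fin.forall_fin_succ]
        split_ifs <;> simp_all

theorem mem_convexHull_image_iff_dotProduct {n p : ℕ} (Y : Fin n → Fin p → ℝ) (x : Fin p → ℝ)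
    (I : Finset (Fin n)) :
    {f : Fin p → ℝ | ∀ i ∈ I, 0 < f ⬝ᵥ (Y i - x)}.Nonempty ↔
      x ∉ convexHull ℝ (Y '' I) := by
  constructor
  · rintro ⟨f, hf⟩ hx
    have hcv : Convex ℝ {y | 0 < f ⬝ᵥ (y - x)} := by
      simp only [dotProduct_sub, sub_pos]
      exact convex_halfSpace_gt ⟨fun a b => dotProduct_add _ _ _, fun a b => dotProduct_smul _ _ _⟩ _
    have : convexHull ℝ (Y '' I) ⊆ {y | 0 < f ⬝ᵥ (y - x)} := by
      refine convexHull_min ?_ hcv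
      rintro _ ⟨i, hi, rfl⟩
      exact hf i hi
    simpa using this hx
  · intro hx
    obtain ⟨f, u, hfx, hfu⟩ := geometric_hahn_banach_point_closed (convex_convexHull ℝ _)
      ((I.finite_toSet.image Y).isClosed_convexHull (𝕜 := ℝ)) hx
    refine ⟨fun i => f (Pi.single i 1), fun i hi => ?_⟩
    have : ∀ y, (fun i => f (Pi.single i 1)) ⬝ᵥ y = f y := by
      intro y
      have := LinearMap.pi_apply_eq_sum_univ f.toLinearMap y
      simp only [ContinuousLinearMap.coe_coe] at this
      rw [this, dotProduct]
      refine Finset.sum_congr rfl fun i _ => ?_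
      rw [smul_eq_mul, mul_comm]
      congr 2
      ext j
      simp [Pi.single_apply, eq_comm]
    rw [this, map_sub, sub_pos]
    exact hfx.trans (hfu _ (subset_convexHull ℝ _ ⟨i, hi, rfl⟩))

theorem sum_indicator_convexHull_of_notMem_frontier {n p : ℕ} (Y : Fin n → Fin p → ℝ)
    (x : Fin p → ℝ) (hx : x ∉ frontier (convexHull ℝ (Set.range Y))) :
    ∑ I : Finset (Fin n), (-1 : ℝ) ^ (I.card + 1) *
      (convexHull ℝ (Y '' I)).indicator 1 x
      = (-1) ^ p * (convexHull ℝ (Set.range Y)).indicator 1 x := by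
  by_cases hmem : x ∈ convexHull ℝ (Set.range Y)
  swap
  · have : ∀ I : Finset (Fin n), x ∉ convexHull ℝ (Y '' I) :=
      fun I h => hmem (convexHull_mono (Set.image_subset_range _ _) h)
    simp [this, hmem]
  have hint : x ∈ interior (convexHull ℝ (Set.range Y)) := by
    by_contra h
    exact hx ⟨subset_closure hmem, h⟩
  have hn : (Finset.univ : Finset (Fin n)).Nonempty := by
    obtain ⟨_, i, rfl⟩ := (convexHull_nonempty_iff (𝕜 := ℝ)).1 ⟨x, hmem⟩
    exact ⟨i, Finset.mem_univ _⟩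
  have hzero : ∀ f : Fin p → ℝ, (∀ i, f ⬝ᵥ (Y i - x) ≤ 0) → f = 0 := by
    intro f hf
    have hcv : Convex ℝ {y | f ⬝ᵥ (y - x) ≤ 0} := by
      simp only [dotProduct_sub, sub_nonpos]
      exact convex_halfSpace_le ⟨fun a b => dotProduct_add _ _ _, fun a b => dotProduct_smul _ _ _⟩ _
    have hsub : convexHull ℝ (Set.range Y) ⊆ {y | f ⬝ᵥ (y - x) ≤ 0} := by
      refine convexHull_min ?_ hcv
      rintro _ ⟨i, rfl⟩
      exact hf i
    have hlim : Filter.Tendsto (fun ε : ℝ => x + ε • f) (nhdsWithin 0 (Set.Ioi 0)) (nhds x) := by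
      have : Continuous fun ε : ℝ => x + ε • f := by fun_prop
      simpa using (this.tendsto 0).mono_left nhdsWithin_le_nhds
    obtain ⟨ε, hε, hε0⟩ := ((hlim.eventually (isOpen_interior.mem_nhds hint)).and
      self_mem_nhdsWithin).exists
    have h1 : f ⬝ᵥ (x + ε • f - x) ≤ 0 := hsub (interior_subset hε)
    rw [add_sub_cancel_left, dotProduct_smul, smul_eq_mul] at h1
    have h2 : f ⬝ᵥ f ≤ 0 := by
      by_contra h
      exact absurd h1 (not_le.2 (mul_pos hε0 (not_le.1 h)))
    refine dotProduct_self_eq_zero.1 (le_antisymm h2 ?_)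
    exact Finset.sum_nonneg fun i _ => mul_self_nonneg _
  have key := euler_relation (fun I : Finset (Fin n) => (-1 : ℝ) ^ I.card) p
    (fun I => {f | ∀ i ∈ I, 0 < f ⬝ᵥ (Y i - x)}) (fun I => ?_) (fun I => ?_) 1 (fun f => ?_)
  · simp only [mem_convexHull_image_iff_dotProduct, ite_not] at key
    have h0 : ∑ I : Finset (Fin n), (-1 : ℝ) ^ I.card = 0 := by
      have := Finset.sum_powerset_neg_one_pow_card_of_nonempty hn
      rw [Finset.powerset_univ] at this
      exact_mod_cast this
    have hsplit : ∀ I : Finset (Fin n),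
        (if x ∈ convexHull ℝ (Y '' I) then 0 else (-1 : ℝ) ^ I.card)
          = (-1) ^ (I.card + 1) * (convexHull ℝ (Y '' I)).indicator 1 x + (-1) ^ I.card := by
      intro I
      by_cases h : x ∈ convexHull ℝ (Y '' I) <;> simp [h, pow_succ]
    simp only [hsplit, Finset.sum_add_distrib, h0, add_zero] at key
    rw [key, Set.indicator_of_mem hmem, Pi.one_apply]
  · have : {f : Fin p → ℝ | ∀ i ∈ I, 0 < f ⬝ᵥ (Y i - x)}
        = ⋂ i ∈ I, {f | 0 < f ⬝ᵥ (Y i - x)} := by ext; simp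
    rw [this]
    refine isOpen_biInter_finset fun i _ => isOpen_lt continuous_const ?_
    unfold dotProduct
    fun_prop
  · have : {f : Fin p → ℝ | ∀ i ∈ I, 0 < f ⬝ᵥ (Y i - x)}
        = ⋂ i ∈ I, {f | 0 < f ⬝ᵥ (Y i - x)} := by ext; simp
    rw [this]
    exact convex_iInter₂ fun i _ => convex_halfSpace_gt
      ⟨fun a b => add_dotProduct _ _ _, fun a b => smul_dotProduct _ _ _⟩ _
  · set S := Finset.univ.filter fun i => 0 < f ⬝ᵥ (Y i - x) with hS
    have h2 : S = ∅ ↔ f = 0 := by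
      rw [hS, Finset.filter_eq_empty_iff]
      simp only [Finset.mem_univ, true_imp_iff, not_lt]
      exact ⟨hzero f, by rintro rfl; simp⟩
    have h1 := Finset.sum_powerset_neg_one_pow_card (x := S)
    simp only [h2] at h1
    have h3 : ∀ I : Finset (Fin n), f ∈ {f : Fin p → ℝ | ∀ i ∈ I, 0 < f ⬝ᵥ (Y i - x)} ↔
        I ∈ S.powerset := by
      intro I; simp [hS, Finset.subset_iff]
    simp only [h3, Finset.sum_ite_mem, Finset.univ_inter]
    exact_mod_cast h1

section Functional

variable {E F : Type*} [NormedAddCommGroup E] [NormedSpace ℝ E] [MeasurableSpace E]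
  [NormedAddCommGroup F] [NormedSpace ℝ F] [MeasurableSpace F]

/-- A nonnegative monotone functional of compact convex sets, measurable on polytopes as a function
of the vertices, which satisfies Cowan's relation with sign `(-1) ^ r`. -/
structure IsCowanFunctional (r : ℕ) (Φ : Set E → ℝ) : Prop where
  mono : ∀ K L : Set E, Convex ℝ K → IsCompact K → Convex ℝ L → IsCompact L → K ⊆ L → Φ K ≤ Φ L
  empty : Φ ∅ = 0
  cowan : ∀ (n : ℕ) (Y : Fin n → E),
    ∑ I : Finset (Fin n), (-1 : ℝ) ^ (I.card + 1) * Φ (convexHull ℝ (Y '' I))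
      = (-1) ^ r * Φ (convexHull ℝ (Set.range Y))
  meas : ∀ (n : ℕ) (I : Finset (Fin n)),
    Measurable fun Y : Fin n → E => Φ (convexHull ℝ (Y '' I))

namespace IsCowanFunctional

variable {r : ℕ} {Φ Ψ : Set E → ℝ}

theorem zero : IsCowanFunctional r (fun _ : Set E => 0) where
  mono := by simp
  empty := rfl
  cowan := by simp
  meas := by simp

theorem add (h : IsCowanFunctional r Φ) (h' : IsCowanFunctional r Ψ) :
    IsCowanFunctional r (fun K => Φ K + Ψ K) where
  mono K L hK hK' hL hL' hKL :=
    add_le_add (h.mono K L hK hK' hL hL' hKL) (h'.mono K L hK hK' hL hL' hKL)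
  empty := by simp [h.empty, h'.empty]
  cowan n Y := by
    simp only [mul_add, Finset.sum_add_distrib, h.cowan, h'.cowan]
  meas n I := (h.meas n I).add (h'.meas n I)

theorem const_mul (h : IsCowanFunctional r Φ) {c : ℝ} (hc : 0 ≤ c) :
    IsCowanFunctional r (fun K => c * Φ K) where
  mono K L hK hK' hL hL' hKL := mul_le_mul_of_nonneg_left (h.mono K L hK hK' hL hL' hKL) hc
  empty := by simp [h.empty]
  cowan n Y := by
    simp only [mul_left_comm _ c, ← Finset.mul_sum, h.cowan]
  meas n I := (h.meas n I).const_mul c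

theorem comp_linear [BorelSpace E] [BorelSpace F] [SecondCountableTopology F]
    {Φ : Set F → ℝ} (h : IsCowanFunctional r Φ) (T : E →L[ℝ] F) :
    IsCowanFunctional r (fun K => Φ (T '' K)) where
  mono K L hK hK' hL hL' hKL := h.mono _ _ (hK.linear_image T.toLinearMap)
    (hK'.image T.continuous) (hL.linear_image T.toLinearMap) (hL'.image T.continuous)
    (Set.image_mono hKL)
  empty := by simp [h.empty]
  cowan n Y := by
    have := h.cowan n (T ∘ Y)
    simp only [Set.range_comp, Set.image_comp] at this
    have e : ∀ s, T '' convexHull ℝ s = convexHull ℝ (T '' s) :=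
      fun s => T.toLinearMap.image_convexHull s
    simpa only [e] using this
  meas n I := by
    have e : ∀ s, T '' convexHull ℝ s = convexHull ℝ (T '' s) :=
      fun s => T.toLinearMap.image_convexHull s
    simp only [e]
    have hm : Measurable fun Y : Fin n → E => (fun i => T (Y i)) :=
      measurable_pi_lambda _ fun i => T.continuous.measurable.comp (measurable_pi_apply i)
    have := (h.meas n I).comp hm
    simp only [Set.image_image]
    exact this

theorem of_tendsto {Φs : ℕ → Set E → ℝ} (h : ∀ m, IsCowanFunctional r (Φs m))
    (hlim : ∀ K, Convex ℝ K → IsCompact K → Filter.Tendsto (fun m => Φs m K) Filter.atTop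
      (nhds (Φ K))) : IsCowanFunctional r Φ := by
  have hfin : ∀ s : Set E, s.Finite → Filter.Tendsto (fun m => Φs m (convexHull ℝ s)) Filter.atTop
      (nhds (Φ (convexHull ℝ s))) := fun s hs => hlim _ (convex_convexHull ℝ s)
        (hs.isCompact_convexHull ℝ)
  refine ⟨fun K L hK hK' hL hL' hKL => ?_, ?_, fun n Y => ?_, fun n I => ?_⟩
  · exact le_of_tendsto_of_tendsto' (hlim K hK hK') (hlim L hL hL')
      fun m => (h m).mono K L hK hK' hL hL' hKL
  · have := hlim ∅ convex_empty isCompact_empty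
    simp only [(h _).empty] at this
    exact tendsto_nhds_unique this tendsto_const_nhds
  · have h1 : Filter.Tendsto (fun m => ∑ I : Finset (Fin n), (-1 : ℝ) ^ (I.card + 1) *
        Φs m (convexHull ℝ (Y '' I))) Filter.atTop (nhds (∑ I : Finset (Fin n),
        (-1 : ℝ) ^ (I.card + 1) * Φ (convexHull ℝ (Y '' I)))) :=
      tendsto_finsetSum _ fun I _ => (hfin _ (I.finite_toSet.image Y)).const_mul _
    simp only [(h _).cowan] at h1
    exact tendsto_nhds_unique h1 ((hfin _ (Set.finite_range Y)).const_mul _)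
  · exact measurable_of_tendsto_metrizable (fun m => (h m).meas n I)
      (tendsto_pi_nhds.2 fun Y => hfin _ (I.finite_toSet.image Y))

end IsCowanFunctional

end Functional

theorem convexHull_range_eq_image_stdSimplex {ι E : Type*} [Fintype ι] [AddCommGroup E]
    [Module ℝ E] (v : ι → E) :
    convexHull ℝ (Set.range v) = (fun w : ι → ℝ => ∑ i, w i • v i) '' stdSimplex ℝ ι := by
  rw [← convexHull_rangle_single_eq_stdSimplex ℝ ι]
  have := (Fintype.linearCombination ℝ v).image_convexHull
    (Set.range fun i : ι => (Pi.single i 1 : ι → ℝ))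
  rw [← Set.range_comp] at this
  have h2 : (Fintype.linearCombination ℝ v ∘ fun i : ι => (Pi.single i 1 : ι → ℝ)) = v := by
    ext i; simp
  rw [h2] at this
  rw [← this]
  rfl

theorem measurableSet_mem_convexHull_image {p n : ℕ} (I : Finset (Fin n)) :
    MeasurableSet {q : (Fin n → Fin p → ℝ) × (Fin p → ℝ) | q.2 ∈ convexHull ℝ (q.1 '' I)} := by
  have hm : Measurable fun q : (Fin n → Fin p → ℝ) × (Fin p → ℝ) =>
      ((fun i : I => q.1 i, q.2) : (I → Fin p → ℝ) × (Fin p → ℝ)) := by fun_prop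
  have hcl : IsClosed {q : (I → Fin p → ℝ) × (Fin p → ℝ) | q.2 ∈ convexHull ℝ (Set.range q.1)} := by
    have hT : IsClosed {z : stdSimplex ℝ I × ((I → Fin p → ℝ) × (Fin p → ℝ)) |
        ∑ i, (z.1 : I → ℝ) i • z.2.1 i = z.2.2} := by
      refine isClosed_eq ?_ (by fun_prop)
      refine continuous_finsetSum _ fun i _ => ?_
      refine Continuous.smul ((continuous_apply i).comp (continuous_subtype_val.comp continuous_fst)) ?_
      fun_prop
    have := isClosedMap_snd_of_compactSpace _ hT
    convert this using 1
    ext q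
    rw [Set.mem_ofPred_eq, convexHull_range_eq_image_stdSimplex]
    constructor
    · rintro ⟨w, hw, hq⟩
      exact ⟨(⟨w, hw⟩, q), hq, rfl⟩
    · rintro ⟨⟨w, q⟩, hq, rfl⟩
      exact ⟨w, w.2, hq⟩
  convert hm hcl.measurableSet using 1
  ext q
  have : q.1 '' I = Set.range fun i : I => q.1 i := by
    ext; simp
  simp [this]

theorem isCowanFunctional_volume (p : ℕ) :
    IsCowanFunctional p (fun K : Set (Fin p → ℝ) => (volume K).toReal) where
  mono K L _ _ _ hL hKL := ENNReal.toReal_mono hL.measure_lt_top.ne (measure_mono hKL)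
  empty := by simp
  cowan n Y := by
    have hcpt : ∀ s : Set (Fin p → ℝ), s.Finite → IsCompact (convexHull ℝ s) :=
      fun s hs => (hs.isCompact_convexHull ℝ)
    have hvol : ∀ s : Set (Fin p → ℝ), s.Finite → (volume (convexHull ℝ s)).toReal
        = ∫ x, (convexHull ℝ s).indicator (1 : (Fin p → ℝ) → ℝ) x := by
      intro s hs
      rw [integral_indicator_one (hcpt s hs).measurableSet]
      rfl
    have hi : ∀ s : Set (Fin p → ℝ), s.Finite →
        Integrable ((convexHull ℝ s).indicator (1 : (Fin p → ℝ) → ℝ)) := by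
      intro s hs
      exact (integrable_indicator_iff (hcpt s hs).measurableSet).2
        (integrableOn_const (hcpt s hs).measure_lt_top.ne)
    rw [hvol _ (Set.finite_range Y)]
    simp only [hvol _ ((Finset.finite_toSet _).image Y)]
    simp only [← integral_const_mul]
    rw [← integral_finsetSum _ fun I _ => (hi _ (I.finite_toSet.image Y)).const_mul _]
    refine integral_congr_ae ?_
    have : ∀ᵐ x, x ∉ frontier (convexHull ℝ (Set.range Y)) := 
      measure_eq_zero_iff_ae_notMem.1 ((convex_convexHull ℝ _).addHaar_frontier volume)
    filter_upwards [this] with x hx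
    exact sum_indicator_convexHull_of_notMem_frontier Y x hx
  meas n I := (measurable_measure_prodMk_left (measurableSet_mem_convexHull_image I)).ennreal_toReal

theorem volume_add_Icc_of_convex {J : Set ℝ} (hc : Convex ℝ J) (hJ : IsCompact J) {s : ℝ}
    (hs : 0 ≤ s) :
    volume (J + Set.Icc (-s) s) = volume J + if J.Nonempty then ENNReal.ofReal (2 * s) else 0 := by
  by_cases hne : J.Nonempty
  · have e : J = Set.Icc (sInf J) (sSup J) :=
      eq_Icc_of_connected_compact ⟨hne, hc.isPreconnected⟩ hJ
    have hle : sInf J ≤ sSup J := csInf_le_csSup hne hJ.bddBelow hJ.bddAbove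
    rw [if_pos hne, e, Set.Icc_add_Icc hle (by linarith), Real.volume_Icc, Real.volume_Icc,
      ← ENNReal.ofReal_add (by linarith) (by linarith)]
    congr 1
    ring
  · rw [Set.not_nonempty_iff_eq_empty] at hne
    simp [hne]

theorem volume_eq_lintegral_fiber {p : ℕ} {K : Set (Fin (p + 1) → ℝ)} (hK : MeasurableSet K) :
    volume K = ∫⁻ w : Fin p → ℝ, volume {t : ℝ | (Fin.cons t w : Fin (p + 1) → ℝ) ∈ K} := by
  have h := (volume_preserving_piFinSuccAbove (fun _ : Fin (p + 1) => ℝ) 0).symm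
  rw [← h.measure_preimage_equiv K]
  rw [Measure.volume_eq_prod, Measure.prod_apply_symm (h.measurable hK)]
  refine lintegral_congr fun w => congrArg _ ?_
  ext t
  simp [MeasurableEquiv.piFinSuccAbove, Fin.insertNthEquiv]

theorem volume_add_smul_segment_single {p : ℕ} {K : Set (Fin (p + 1) → ℝ)} (hc : Convex ℝ K)
    (hK : IsCompact K) {s : ℝ} (hs : 0 ≤ s) :
    volume (K + s • segment ℝ (-Pi.single 0 1) (Pi.single 0 1 : Fin (p + 1) → ℝ))
      = volume K + ENNReal.ofReal (2 * s) *
        volume ((ContinuousLinearMap.pi fun i : Fin p =>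
          ContinuousLinearMap.proj (R := ℝ) (φ := fun _ : Fin (p + 1) => ℝ) i.succ) '' K) := by
  set T := (ContinuousLinearMap.pi fun i : Fin p =>
          ContinuousLinearMap.proj (R := ℝ) (φ := fun _ : Fin (p + 1) => ℝ) i.succ) with hT
  set e : Fin (p + 1) → ℝ := Pi.single 0 1 with he
  have hcons : ∀ w : Fin p → ℝ, Continuous fun t : ℝ => (Fin.cons t w : Fin (p + 1) → ℝ) := by
    intro w
    refine continuous_pi fun i => ?_
    refine Fin.cases ?_ (fun i => ?_) i
    · simpa using continuous_id'
    · simpa using continuous_const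
  have hseg : IsCompact (segment ℝ (-e) e) := by
    rw [segment_eq_image']
    exact isCompact_Icc.image (by fun_prop)
  have hmem : ∀ z, z ∈ s • segment ℝ (-e) e ↔ ∃ t ∈ Set.Icc (-s) s, z = t • e := by
    intro z
    rw [segment_eq_image']
    constructor
    · rintro ⟨_, ⟨θ, hθ, rfl⟩, rfl⟩
      refine ⟨s * (2 * θ - 1), ⟨by nlinarith [hθ.1, hθ.2], by nlinarith [hθ.1, hθ.2]⟩, ?_⟩
      simp only []
      module
    · rintro ⟨t, ht, rfl⟩
      rcases hs.eq_or_lt with rfl | hs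
      · have : t = 0 := by linarith [ht.1, ht.2]
        subst this
        exact ⟨-e, ⟨0, by simp, by simp⟩, by simp⟩
      · refine ⟨_, ⟨(t / s + 1) / 2, ⟨?_, ?_⟩, rfl⟩, ?_⟩
        · have : -1 ≤ t / s := by rw [le_div_iff₀ hs]; linarith [ht.1]
          linarith
        · have : t / s ≤ 1 := by rw [div_le_iff₀ hs]; linarith [ht.2]
          linarith
        · simp only []
          have : s • (-e + ((t / s + 1) / 2) • (e - -e)) = (s * (t / s)) • e := by module
          rw [this, mul_div_cancel₀ _ hs.ne']
  have hfib : ∀ w : Fin p → ℝ,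
      {t : ℝ | (Fin.cons t w : Fin (p + 1) → ℝ) ∈ K + s • segment ℝ (-e) e}
        = {t : ℝ | (Fin.cons t w : Fin (p + 1) → ℝ) ∈ K} + Set.Icc (-s) s := by
    intro w
    have hshift : ∀ a b : ℝ, (Fin.cons a w : Fin (p + 1) → ℝ) + b • e = Fin.cons (a + b) w := by
      intro a b
      ext i
      refine Fin.cases ?_ (fun i => ?_) i
      · simp [he]
      · simp [he]
    ext t
    constructor
    · rintro ⟨k, hk, z, hz, hkz⟩
      obtain ⟨τ, hτ, rfl⟩ := (hmem z).1 hz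
      refine ⟨t - τ, ?_, τ, hτ, by simp⟩
      have : k = Fin.cons (t - τ) w := by
        rw [sub_eq_add_neg, ← hshift, ← hkz, neg_smul]
        simp
      rw [Set.mem_ofPred_eq, ← this]
      exact hk
    · rintro ⟨a, ha, b, hb, rfl⟩
      exact ⟨_, ha, _, (hmem _).2 ⟨b, hb, rfl⟩, hshift a b⟩
  have hcompact : ∀ w : Fin p → ℝ, IsCompact {t : ℝ | (Fin.cons t w : Fin (p + 1) → ℝ) ∈ K} := by
    intro w
    refine (hK.image (continuous_apply (0 : Fin (p + 1)))).of_isClosed_subset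
      (hK.isClosed.preimage (hcons w)) ?_
    intro t ht
    exact ⟨_, ht, by simp⟩
  have hconv : ∀ w : Fin p → ℝ, Convex ℝ {t : ℝ | (Fin.cons t w : Fin (p + 1) → ℝ) ∈ K} := by
    intro w x hx y hy α β hα hβ hαβ
    have := hc hx hy hα hβ hαβ
    have e : α • (Fin.cons x w : Fin (p + 1) → ℝ) + β • (Fin.cons y w : Fin (p + 1) → ℝ)
        = Fin.cons (α • x + β • y) w := by
      ext i
      refine Fin.cases ?_ (fun i => ?_) i
      · simp
      · simp [← add_mul, hαβ]
    rwa [e] at this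
  have hne : ∀ w : Fin p → ℝ,
      ({t : ℝ | (Fin.cons t w : Fin (p + 1) → ℝ) ∈ K}).Nonempty ↔ w ∈ T '' K := by
    intro w
    constructor
    · rintro ⟨t, ht⟩
      exact ⟨_, ht, by ext i; simp [hT]⟩
    · rintro ⟨x, hx, rfl⟩
      refine ⟨x 0, ?_⟩
      have : (Fin.cons (x 0) (T x) : Fin (p + 1) → ℝ) = x := by
        ext i
        refine Fin.cases ?_ (fun i => ?_) i <;> simp [hT]
      rw [Set.mem_ofPred_eq, this]
      exact hx
  have hTK : MeasurableSet (T '' K) := (hK.image T.continuous).measurableSet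
  rw [volume_eq_lintegral_fiber (hK.add (hseg.smul s)).measurableSet,
    volume_eq_lintegral_fiber hK.measurableSet]
  simp only [hfib, volume_add_Icc_of_convex (hconv _) (hcompact _) hs, hne]
  rw [lintegral_add_right]
  · congr 1
    have := lintegral_indicator_const (μ := (volume : Measure (Fin p → ℝ))) hTK
      (ENNReal.ofReal (2 * s))
    rw [← this]
    rfl
  · exact Measurable.ite hTK measurable_const measurable_const

theorem image_segment_neg {E F : Type*} [AddCommGroup E] [Module ℝ E] [AddCommGroup F]
    [Module ℝ F] (T : E →ₗ[ℝ] F) (u : E) :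
    T '' segment ℝ (-u) u = segment ℝ (-T u) (T u) := by
  have := image_segment ℝ T.toAffineMap (-u) u
  simpa using this

theorem image_add_smul_segment {E F : Type*} [AddCommGroup E] [Module ℝ E] [AddCommGroup F]
    [Module ℝ F] (T : E →ₗ[ℝ] F) (K : Set E) (s : ℝ) (u : E) :
    T '' (K + s • segment ℝ (-u) u) = T '' K + s • segment ℝ (-T u) (T u) := by
  rw [Set.image_add, image_smul_set, image_segment_neg]

/-- Adding a segment changes the volume by a multiple of the volume of a projection. -/
theorem exists_volume_add_smul_segment {p : ℕ} (u : Fin (p + 1) → ℝ) :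
    ∃ (T : (Fin (p + 1) → ℝ) →L[ℝ] (Fin p → ℝ)) (c : ℝ), 0 ≤ c ∧
      ∀ K, Convex ℝ K → IsCompact K → ∀ s : ℝ, 0 ≤ s →
        (volume (K + s • segment ℝ (-u) u)).toReal
          = (volume K).toReal + s * (c * (volume (T '' K)).toReal) := by
  by_cases hu : u = 0
  · refine ⟨0, 0, le_rfl, fun K _ _ s _ => ?_⟩
    simp [hu]
  obtain ⟨L, hL⟩ := SeparatingDual.exists_continuousLinearEquiv_apply_eq (R := ℝ) hu
    (y := (Pi.single 0 1 : Fin (p + 1) → ℝ)) (by simp)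
  set δ : ℝ := |LinearMap.det (L : (Fin (p + 1) → ℝ) →ₗ[ℝ] (Fin (p + 1) → ℝ))| with hδ
  have hδ0 : 0 < δ := abs_pos.2 (LinearEquiv.isUnit_det' L.toLinearEquiv).ne_zero
  have hvol : ∀ S : Set (Fin (p + 1) → ℝ), (volume S).toReal = δ⁻¹ * (volume (L '' S)).toReal := by
    intro S
    rw [Measure.addHaar_image_continuousLinearEquiv, ENNReal.toReal_mul,
      ENNReal.toReal_ofReal (abs_nonneg _), ← hδ, inv_mul_cancel_left₀ hδ0.ne']
  set T₀ := (ContinuousLinearMap.pi fun i : Fin p =>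
    ContinuousLinearMap.proj (R := ℝ) (φ := fun _ : Fin (p + 1) => ℝ) i.succ) with hT₀
  refine ⟨T₀.comp L.toContinuousLinearMap, δ⁻¹ * 2, by positivity, fun K hc hK s hs => ?_⟩
  have hcL : Convex ℝ (L '' K) := hc.linear_image L.toLinearEquiv.toLinearMap
  have hKL : IsCompact (L '' K) := hK.image L.continuous
  have himg : L '' (K + s • segment ℝ (-u) u) = L '' K + s • segment ℝ (-L u) (L u) :=
    image_add_smul_segment L.toLinearEquiv.toLinearMap K s u
  rw [hvol, hvol K, himg, hL, volume_add_smul_segment_single hcL hKL hs, ENNReal.toReal_add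
    hKL.measure_lt_top.ne, ENNReal.toReal_mul, ENNReal.toReal_ofReal (by linarith)]
  · have : (T₀.comp L.toContinuousLinearMap) '' K = T₀ '' (L '' K) := by
      rw [← Set.image_comp]; rfl
    rw [this]
    ring
  · exact ENNReal.mul_ne_top ENNReal.ofReal_ne_top (hKL.image T₀.continuous).measure_lt_top.ne

/-- The zonotope spanned by the segments `[-u, u]`. -/
def zonotope {E : Type*} [AddCommGroup E] [Module ℝ E] (l : List E) : Set E :=
  (l.map fun u => segment ℝ (-u) u).sum

theorem image_zonotope {E F : Type*} [AddCommGroup E] [Module ℝ E] [AddCommGroup F]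
    [Module ℝ F] (T : E →ₗ[ℝ] F) (l : List E) : T '' zonotope l = zonotope (l.map T) := by
  induction l with
  | nil => simp [zonotope, Set.singleton_zero]
  | cons u l ih =>
    simp only [zonotope, List.map_cons, List.sum_cons] at ih ⊢
    rw [Set.image_add, ih, image_segment_neg]

theorem isCompact_zonotope {E : Type*} [AddCommGroup E] [Module ℝ E] [TopologicalSpace E]
    [ContinuousAdd E] [ContinuousSMul ℝ E] (l : List E) : IsCompact (zonotope l) := by
  induction l with
  | nil => simp [zonotope]
  | cons u l ih =>
    simp only [zonotope, List.map_cons, List.sum_cons] at ih ⊢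
    refine IsCompact.add ?_ ih
    rw [segment_eq_image]
    exact isCompact_Icc.image (by fun_prop)

theorem convex_zonotope {E : Type*} [AddCommGroup E] [Module ℝ E] (l : List E) :
    Convex ℝ (zonotope l) := by
  induction l with
  | nil => simp [zonotope, ← Set.singleton_zero]
  | cons u l ih =>
    simp only [zonotope, List.map_cons, List.sum_cons] at ih ⊢
    exact (convex_segment _ _).add ih

theorem exists_volume_add_smul_zonotope (p : ℕ) : ∀ l : List (Fin p → ℝ),
    ∃ e : ℕ → Set (Fin p → ℝ) → ℝ, (∀ k ≤ p, IsCowanFunctional (p - k) (e k)) ∧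
      ∀ K, Convex ℝ K → IsCompact K → ∀ s : ℝ, 0 ≤ s →
        (volume (K + s • zonotope l)).toReal = ∑ k ∈ Finset.range (p + 1), s ^ k * e k K := by
  induction p with
  | zero =>
    intro l
    refine ⟨fun _ K => (volume K).toReal, fun k hk => ?_, fun K _ _ s _ => ?_⟩
    · rw [Nat.zero_sub]; exact isCowanFunctional_volume 0
    · have : s • zonotope l = 0 := by
        have hne : (zonotope l).Nonempty := by
          induction l with
          | nil => simp [zonotope]
          | cons u l ih =>
            simp only [zonotope, List.map_cons, List.sum_cons] at ih ⊢
            exact (Set.Nonempty.add ⟨-u, left_mem_segment _ _ _⟩ ih)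
        exact Set.Nonempty.subset_zero_iff (hne.smul_set) |>.1 fun x _ => Subsingleton.elim _ _
      simp [this]
  | succ p ihp =>
    intro l
    induction l with
    | nil =>
      refine ⟨fun k K => if k = 0 then (volume K).toReal else 0, fun k hk => ?_,
        fun K _ _ s _ => ?_⟩
      · by_cases h : k = 0
        · simpa [h] using isCowanFunctional_volume (p + 1)
        · simpa [h] using IsCowanFunctional.zero
      · rw [Finset.sum_eq_single 0] <;> simp +contextual [zonotope]
    | cons u l ihl =>
      obtain ⟨e, he, hel⟩ := ihl
      obtain ⟨T, c, hc, hT⟩ := exists_volume_add_smul_segment u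
      obtain ⟨e', he', hel'⟩ := ihp (l.map T)
      refine ⟨fun k K => e k K + if k = 0 then 0 else c * e' (k - 1) (T '' K), fun k hk => ?_,
        fun K hcv hK s hs => ?_⟩
      · refine (he k hk).add ?_
        rcases k with _ | k
        · simpa using IsCowanFunctional.zero
        · have := ((he' k (by omega)).comp_linear T).const_mul hc
          rw [Nat.add_sub_add_right]
          simpa using this
      · have hz : K + s • zonotope (u :: l) = (K + s • zonotope l) + s • segment ℝ (-u) u := by
          simp only [zonotope, List.map_cons, List.sum_cons, smul_add]
          rw [add_assoc, add_comm (s • (List.map _ l).sum)]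
        have himg : T '' (K + s • zonotope l) = T '' K + s • zonotope (l.map T) := by
          have h1 : T '' zonotope l = zonotope (l.map T) := image_zonotope T.toLinearMap l
          have h2 : T '' (s • zonotope l) = s • (T '' zonotope l) :=
            image_smul_set ..
          rw [Set.image_add, h2, h1]
        rw [hz, hT _ (hcv.add ((convex_zonotope l).smul s)) (hK.add ((isCompact_zonotope l).smul s))
          s hs, hel K hcv hK s hs, himg, hel' (T '' K)
          (hcv.linear_image T.toLinearMap) (hK.image T.continuous) s hs]
        simp only [mul_add, Finset.sum_add_distrib]
        congr 1
        rw [Finset.sum_range_succ' _ (p + 1)]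
        simp only [Finset.mul_sum, if_true, Nat.add_sub_cancel, mul_zero, add_zero,
          Nat.add_one_ne_zero, if_false]
        refine Finset.sum_congr rfl fun k _ => ?_
        ring

section BallApproximation

variable {E : Type*} [NormedAddCommGroup E] [InnerProductSpace ℝ E]

theorem inner_le_of_mem_zonotope (x : E) : ∀ (l : List E), ∀ z ∈ zonotope l,
    inner ℝ z x ≤ (l.map fun u => |inner ℝ u x|).sum := by
  intro l
  induction l with
  | nil => simp [zonotope]
  | cons u l ih =>
    rintro _ ⟨a, ha, b, hb, rfl⟩
    obtain ⟨s, t, hs, ht, hst, rfl⟩ : a ∈ segment ℝ (-u) u := ha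
    simp only [List.map_cons, List.sum_cons, inner_add_left]
    refine add_le_add ?_ (ih b hb)
    simp only [inner_smul_left, inner_neg_left, conj_trivial]
    nlinarith [le_abs_self (inner ℝ u x), neg_abs_le (inner ℝ u x)]

theorem exists_mem_zonotope_inner_eq (x : E) (l : List E) :
    ∃ z ∈ zonotope l, inner ℝ z x = (l.map fun u => |inner ℝ u x|).sum := by
  induction l with
  | nil => exact ⟨0, by simp [zonotope], by simp⟩
  | cons u l ih =>
    obtain ⟨z, hz, h⟩ := ih
    obtain ⟨a, ha, ha'⟩ : ∃ a ∈ segment ℝ (-u) u, inner ℝ a x = |inner ℝ u x| := by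
      rcases abs_choice (inner ℝ u x) with h | h
      · exact ⟨u, right_mem_segment _ _ _, h.symm⟩
      · exact ⟨-u, left_mem_segment _ _ _, by rw [h, inner_neg_left]⟩
    exact ⟨a + z, Set.add_mem_add ha hz, by simp [inner_add_left, ha', h]⟩

theorem zonotope_subset_closedBall {l : List E} {R : ℝ} (hR : 0 ≤ R)
    (h : ∀ x : E, (l.map fun u => |inner ℝ u x|).sum ≤ R * ‖x‖) :
    zonotope l ⊆ Metric.closedBall 0 R := by
  intro z hz
  rw [mem_closedBall_zero_iff]
  have h0 := (inner_le_of_mem_zonotope z l z hz).trans (h z)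
  rw [real_inner_self_eq_norm_mul_norm] at h0
  by_contra! hlt
  nlinarith

theorem closedBall_subset_zonotope [FiniteDimensional ℝ E] {l : List E}
    (h : ∀ x : E, ‖x‖ ≤ (l.map fun u => |inner ℝ u x|).sum) :
    Metric.closedBall 0 1 ⊆ zonotope l := by
  intro y hy
  rw [mem_closedBall_zero_iff] at hy
  by_contra hyz
  obtain ⟨f, t, hf, ht⟩ :=
    geometric_hahn_banach_closed_point (convex_zonotope l) (isCompact_zonotope l).isClosed hyz
  set w := (InnerProductSpace.toDual ℝ E).symm f with hw
  have hfw : ∀ a, f a = inner ℝ a w := fun a => by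
    rw [real_inner_comm, hw, InnerProductSpace.toDual_symm_apply]
  obtain ⟨z, hz, hzw⟩ := exists_mem_zonotope_inner_eq w l
  have h1 := hf z hz
  rw [hfw] at h1 ht
  have h2 := real_inner_le_norm y w
  have h3 := h w
  nlinarith [norm_nonneg w]

variable [FiniteDimensional ℝ E] [MeasurableSpace E] [BorelSpace E]

theorem setIntegral_ball_abs_inner_eq {x y : E} (h : ‖x‖ = ‖y‖) :
    ∫ u in Metric.closedBall (0 : E) 1, |inner ℝ u x|
      = ∫ u in Metric.closedBall (0 : E) 1, |inner ℝ u y| := by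
  set R := (ℝ ∙ (x - y))ᗮ.reflection with hR
  have hxy : R x = y := Submodule.reflection_sub h
  have := (R.measurePreserving).setIntegral_preimage_emb
    R.toHomeomorph.measurableEmbedding (fun u => |inner ℝ u y|) (Metric.closedBall (0 : E) 1)
  rw [← this]
  have hpre : R ⁻¹' Metric.closedBall (0 : E) 1 = Metric.closedBall 0 1 := by
    ext u; simp
  rw [hpre]
  simp only [← hxy, LinearIsometryEquiv.inner_map_map]

theorem setIntegral_ball_abs_inner_pos {x : E} (hx : x ≠ 0) :
    0 < ∫ u in Metric.closedBall (0 : E) 1, |inner ℝ u x| := by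
  have hc : Continuous fun u : E => |inner ℝ u x| := by fun_prop
  rw [setIntegral_pos_iff_support_of_nonneg_ae (ae_of_all _ fun u => abs_nonneg _)
    (hc.continuousOn.integrableOn_compact (isCompact_closedBall 0 1))]
  have ho : IsOpen (Function.support (fun u : E => |inner ℝ u x|) ∩ Metric.ball 0 1) :=
    (isOpen_ne_fun hc continuous_const).inter Metric.isOpen_ball
  refine (ho.measure_pos volume ⟨(2 * ‖x‖)⁻¹ • x, ?_, ?_⟩).trans_le
    (measure_mono (Set.inter_subset_inter_right _ Metric.ball_subset_closedBall))
  · simp [inner_smul_left, hx]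
  · rw [mem_ball_zero_iff, norm_smul, norm_inv, norm_mul, norm_norm, Real.norm_ofNat]
    have := norm_pos_iff.2 hx
    field_simp
    norm_num

theorem exists_list_abs_sum_inner_sub_le [Nontrivial E] : ∃ a : ℝ, 0 < a ∧ ∀ η : ℝ, 0 < η →
    ∃ l : List E, ∀ x : E, ‖x‖ = 1 → |(l.map fun u => |inner ℝ u x|).sum - a| ≤ η := by
  obtain ⟨x₀, hx₀⟩ := exists_norm_eq E zero_le_one
  set B : Set E := Metric.closedBall (0 : E) 1
  have hB : 0 < volume.real B := by
    refine ENNReal.toReal_pos (Metric.measure_closedBall_pos _ _ one_pos).ne'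
      measure_closedBall_lt_top.ne
  let F : C(E, C(Metric.sphere (0 : E) 1, ℝ)) :=
    ContinuousMap.curry ⟨fun p => |inner ℝ p.1 (p.2 : E)|, by fun_prop⟩
  let S : Set C(Metric.sphere (0 : E) 1, ℝ) :=
    {g | ∃ l : List E, ∀ x, g x = (l.map fun u => |inner ℝ u (x : E)|).sum}
  have hscale : ∀ (l : List E) (t : ℝ), 0 ≤ t → ∀ x : E,
      ((l.map (t • ·)).map fun u => |inner ℝ u x|).sum
        = t * (l.map fun u => |inner ℝ u x|).sum := by
    intro l t ht x
    rw [← List.sum_map_mul_left, List.map_map]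
    simp [Function.comp_def, inner_smul_left, abs_mul, abs_of_nonneg ht]
  have hS : Convex ℝ S := by
    rintro g ⟨l, hl⟩ g' ⟨l', hl'⟩ s t hs ht -
    refine ⟨l.map (s • ·) ++ l'.map (t • ·), fun x => ?_⟩
    rw [List.map_append, List.sum_append, hscale l s hs, hscale l' t ht]
    simp [hl, hl']
  have hFi : IntegrableOn F B := F.continuous.continuousOn.integrableOn_compact
    (isCompact_closedBall 0 1)
  have hmem : ⨍ u in B, F u ∈ closure S := by
    refine hS.closure.set_average_mem isClosed_closure
      (Metric.measure_closedBall_pos _ _ one_pos).ne' measure_closedBall_lt_top.ne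
      (ae_of_all _ fun u => subset_closure ⟨[u], fun x => ?_⟩) hFi
    simp [F]
  have hval : ∀ x, (⨍ u in B, F u) x = (volume.real B)⁻¹ * ∫ u in B, |inner ℝ u x₀| := by
    intro x
    rw [setAverage_eq, ContinuousMap.smul_apply, smul_eq_mul,
      ← setIntegral_ball_abs_inner_eq (x := (x : E)) (y := x₀) (by simp [hx₀])]
    congr 1
    exact ((ContinuousMap.evalCLM ℝ x).integral_comp_comm hFi).symm
  refine ⟨(volume.real B)⁻¹ * ∫ u in B, |inner ℝ u x₀|, mul_pos (inv_pos.2 hB)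
    (setIntegral_ball_abs_inner_pos (by rintro rfl; simp at hx₀)), fun η hη => ?_⟩
  obtain ⟨g, ⟨l, hl⟩, hg⟩ := Metric.mem_closure_iff.1 hmem η hη
  refine ⟨l, fun x hx => ?_⟩
  rw [dist_comm] at hg
  have := (ContinuousMap.dist_apply_le_dist (f := g) (g := ⨍ u in B, F u)
    ⟨x, by simpa using hx⟩).trans hg.le
  rwa [hval, hl, Real.dist_eq] at this

theorem exists_zonotope_closedBall {δ : ℝ} (hδ : 0 < δ) : ∃ l : List E,
    Metric.closedBall (0 : E) 1 ⊆ zonotope l ∧ zonotope l ⊆ Metric.closedBall 0 (1 + δ) := by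
  rcases subsingleton_or_nontrivial E with hE | hE
  · refine ⟨[], fun x _ => ?_, fun x _ => ?_⟩
    · simp [zonotope, Subsingleton.elim x 0]
    · simp [Subsingleton.elim x 0]; positivity
  obtain ⟨a, ha, h⟩ := exists_list_abs_sum_inner_sub_le (E := E)
  have ht : 0 < (1 + δ / 2) / a := by positivity
  set t := (1 + δ / 2) / a with htdef
  obtain ⟨l, hl⟩ := h (δ / 2 / t) (by positivity)
  have hta : t * a = 1 + δ / 2 := by rw [htdef]; field_simp
  have key : ∀ x : E, ‖x‖ ≤ ((l.map (t • ·)).map fun u => |inner ℝ u x|).sum ∧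
      ((l.map (t • ·)).map fun u => |inner ℝ u x|).sum ≤ (1 + δ) * ‖x‖ := by
    intro x
    rcases eq_or_ne x 0 with rfl | hx
    · simp [Function.comp_def]
    have hx' := norm_pos_iff.2 hx
    have h1 := hl (‖x‖⁻¹ • x) (by rw [norm_smul, norm_inv, norm_norm, inv_mul_cancel₀ hx'.ne'])
    have e1 : ((l.map (t • ·)).map fun u => |inner ℝ u x|).sum
        = ‖x‖ * (t * (l.map fun u => |inner ℝ u (‖x‖⁻¹ • x)|).sum) := by
      rw [← List.sum_map_mul_left, ← List.sum_map_mul_left, List.map_map]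
      congr 1
      refine List.map_congr_left fun u _ => ?_
      simp only [Function.comp, inner_smul_left, inner_smul_right, abs_mul, conj_trivial,
        abs_of_pos ht, abs_inv, abs_norm]
      field_simp
    set σ := (l.map fun u => |inner ℝ u (‖x‖⁻¹ • x)|).sum
    have h2 : |t * σ - (1 + δ / 2)| ≤ δ / 2 := by
      rw [← hta, ← mul_sub, abs_mul, abs_of_pos ht]
      calc t * |σ - a| ≤ t * (δ / 2 / t) := by gcongr
        _ = δ / 2 := by field_simp
    rw [abs_le] at h2
    rw [e1]
    constructor <;> nlinarith
  exact ⟨_, closedBall_subset_zonotope fun x => (key x).1,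
    zonotope_subset_closedBall (by positivity) fun x => (key x).2⟩

end BallApproximation

section IntrinsicVolumes

theorem exists_volume_add_smul_zonotope_euclidean (d : ℕ) (l : List (EuclideanSpace ℝ (Fin d))) :
    ∃ e : ℕ → Set (EuclideanSpace ℝ (Fin d)) → ℝ, (∀ k ≤ d, IsCowanFunctional (d - k) (e k)) ∧
      ∀ K, Convex ℝ K → IsCompact K → ∀ s : ℝ, 0 ≤ s →
        (volume (K + s • zonotope l)).toReal = ∑ k ∈ Finset.range (d + 1), s ^ k * e k K := by
  set T := EuclideanSpace.equiv (Fin d) ℝ with hT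
  obtain ⟨e, he, hel⟩ := exists_volume_add_smul_zonotope d (l.map T)
  refine ⟨fun k K => e k (T '' K), fun k hk => (he k hk).comp_linear T.toContinuousLinearMap,
    fun K hcv hK s hs => ?_⟩
  have himg : T '' (K + s • zonotope l) = T '' K + s • zonotope (l.map T) := by
    have h1 : T '' zonotope l = zonotope (l.map T) := image_zonotope T.toLinearMap l
    have h2 : T '' (s • zonotope l) = s • (T '' zonotope l) := image_smul_set ..
    rw [Set.image_add, h2, h1]
  have hvol : ∀ S, volume (T '' S) = volume S := fun S => by
    have h := EuclideanSpace.volume_preserving_symm_measurableEquiv_toLp (Fin d)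
    rw [← h.measure_preimage_equiv (T '' S)]
    exact congrArg volume (T.injective.preimage_image S)
  rw [← hvol, himg, hel (T '' K) (hcv.linear_image T.toLinearMap) (hK.image T.continuous) s hs]

theorem tendsto_coeff_of_tendsto_sum {d : ℕ} {a : ℕ → ℕ → ℝ} {b : ℕ → ℝ}
    (h : ∀ s : ℝ, 0 ≤ s → Filter.Tendsto (fun m => ∑ k ∈ Finset.range (d + 1), s ^ k * a m k)
      Filter.atTop (nhds (∑ k ∈ Finset.range (d + 1), s ^ k * b k))) {k : ℕ} (hk : k ≤ d) :
    Filter.Tendsto (fun m => a m k) Filter.atTop (nhds (b k)) := by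
  set A : Matrix (Fin (d + 1)) (Fin (d + 1)) ℝ :=
    Matrix.vandermonde fun i : Fin (d + 1) => ((i : ℕ) : ℝ) with hA
  have hdet : IsUnit A.det := by
    rw [isUnit_iff_ne_zero, hA, Matrix.det_vandermonde_ne_zero_iff]
    exact Nat.cast_injective.comp Fin.val_injective
  have hmul : ∀ c : ℕ → ℝ, A.mulVec (fun i => c i)
      = fun i : Fin (d + 1) => ∑ k ∈ Finset.range (d + 1), ((i : ℕ) : ℝ) ^ k * c k := by
    intro c
    ext i
    rw [Finset.sum_range]
    rfl
  have hinv : ∀ c : ℕ → ℝ, A⁻¹.mulVec (A.mulVec fun i => c i) ⟨k, by omega⟩ = c k := by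
    intro c
    rw [Matrix.mulVec_mulVec, Matrix.nonsing_inv_mul _ hdet, Matrix.one_mulVec]
  rw [← hinv b]
  simp_rw [← fun m => hinv (a m)]
  simp only [hmul]
  simp only [Matrix.mulVec, dotProduct]
  exact tendsto_finsetSum _ fun i _ => (h _ (Nat.cast_nonneg _)).const_mul _

variable {d : ℕ} {V : ℕ → Set (EuclideanSpace ℝ (Fin d)) → ℝ}

theorem IsIntrinsicVolumes.volume_add_smul_closedBall (hV : IsIntrinsicVolumes d V)
    {K : Set (EuclideanSpace ℝ (Fin d))} (hcv : Convex ℝ K) (hK : IsCompact K) {s : ℝ}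
    (hs : 0 ≤ s) :
    (volume (K + s • Metric.closedBall (0 : EuclideanSpace ℝ (Fin d)) 1)).toReal
      = ∑ k ∈ Finset.range (d + 1), s ^ k * (unitBallVol k * V (d - k) K) := by
  rw [hV K hcv hK s hs, ← Finset.sum_range_reflect]
  refine Finset.sum_congr rfl fun j hj => ?_
  have : j ≤ d := Nat.lt_succ_iff.1 (Finset.mem_range.1 hj)
  rw [Nat.add_sub_cancel, Nat.sub_sub_self this, mul_assoc]

theorem IsIntrinsicVolumes.isCowanFunctional (hV : IsIntrinsicVolumes d V) {r : ℕ} (hr : r ≤ d) :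
    IsCowanFunctional r (V r) := by
  have hδ : ∀ m : ℕ, (0 : ℝ) < 1 / ((m : ℝ) + 1) := fun m => Nat.one_div_pos_of_nat
  choose l hl hl' using fun m => exists_zonotope_closedBall (E := EuclideanSpace ℝ (Fin d)) (hδ m)
  choose e he hel using fun m => exists_volume_add_smul_zonotope_euclidean d (l m)
  have hlim : ∀ K, Convex ℝ K → IsCompact K → Filter.Tendsto (fun m => e m (d - r) K)
      Filter.atTop (nhds (unitBallVol (d - r) * V r K)) := by
    intro K hcv hK
    have key := tendsto_coeff_of_tendsto_sum (d := d) (a := fun m k => e m k K)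
      (b := fun k => unitBallVol k * V (d - k) K) ?_ (Nat.sub_le d r)
    · simpa only [Nat.sub_sub_self hr] using key
    intro s hs
    have hmono : ∀ {A B : Set (EuclideanSpace ℝ (Fin d))}, A ⊆ B → IsCompact B →
        (volume (K + s • A)).toReal ≤ (volume (K + s • B)).toReal := fun hAB hB =>
      ENNReal.toReal_mono (hK.add (hB.smul s)).measure_lt_top.ne
        (measure_mono (Set.add_subset_add_left (Set.smul_set_mono hAB)))
    have hup : Filter.Tendsto (fun m : ℕ => ∑ k ∈ Finset.range (d + 1),
        (s * (1 + 1 / ((m : ℝ) + 1))) ^ k * (unitBallVol k * V (d - k) K)) Filter.atTop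
        (nhds (∑ k ∈ Finset.range (d + 1), s ^ k * (unitBallVol k * V (d - k) K))) := by
      refine tendsto_finsetSum _ fun k _ => Filter.Tendsto.mul_const _ (Filter.Tendsto.pow ?_ k)
      simpa using (tendsto_one_div_add_atTop_nhds_zero_nat.const_add (1 : ℝ)).const_mul s
    refine tendsto_of_tendsto_of_tendsto_of_le_of_le tendsto_const_nhds hup (fun m => ?_)
      fun m => ?_
    · dsimp only
      rw [← hel m K hcv hK s hs, ← hV.volume_add_smul_closedBall hcv hK hs]
      exact hmono (hl m) (isCompact_zonotope _)
    · have h1 : s • Metric.closedBall (0 : EuclideanSpace ℝ (Fin d)) (1 + 1 / ((m : ℝ) + 1))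
          = (s * (1 + 1 / ((m : ℝ) + 1))) • Metric.closedBall 0 1 := by
        rw [mul_smul, smul_unitClosedBall_of_nonneg (by positivity)]
      dsimp only
      rw [← hel m K hcv hK s hs, ← hV.volume_add_smul_closedBall hcv hK (by positivity), ← h1]
      exact hmono (hl' m) (isCompact_closedBall _ _)
  have h := IsCowanFunctional.of_tendsto (fun m => he m (d - r) (Nat.sub_le d r)) hlim
  rw [Nat.sub_sub_self hr] at h
  have := h.const_mul (inv_nonneg.2 (unitBallVol_pos (d - r)).le)
  simpa only [inv_mul_cancel_left₀ (unitBallVol_pos (d - r)).ne'] using this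

end IntrinsicVolumes

/-- **Theorem 1.7.** Let `(X 0, …, X (n-1))` be an exchangeable tuple of random vectors in
`ℝ^d` with `dim Π = d` a.s. Let `0 ≤ r ≤ d` and assume `E V_r(Π) < ∞` (integrability). With
`v_r(k) = E V_r(conv(X 0, …, X (k-1)))`, one has
`Σ_{k=1}^n (−1)^{k−1} (n choose k) v_r(k) = (−1)^r v_r(n)`. -/
theorem cowan_intrinsic_volumes_random (n d r : ℕ) (hr : r ≤ d)
    (Ω : Type) [MeasurableSpace Ω] (P : Measure Ω) [IsProbabilityMeasure P]
    (X : Fin n → Ω → EuclideanSpace ℝ (Fin d)) (hmeas : ∀ i, Measurable (X i))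
    (hexch : ∀ σ : Equiv.Perm (Fin n),
      Measure.map (fun ω => fun i => X (σ i) ω) P = Measure.map (fun ω => fun i => X i ω) P)
    (hdim : ∀ᵐ ω ∂P, adim (convexHull ℝ (Set.range fun i => X i ω)) = d)
    (V : ℕ → Set (EuclideanSpace ℝ (Fin d)) → ℝ) (hV : IsIntrinsicVolumes d V)
    (hint : Integrable (fun ω => V r (convexHull ℝ (Set.range fun i => X i ω))) P)
    (v : ℕ → ℝ)
    (hv : ∀ k, v k =
      ∫ ω, V r (convexHull ℝ ((fun i => X i ω) '' {i : Fin n | (i : ℕ) < k})) ∂P) :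
    ∑ k ∈ Finset.Icc 1 n, (-1 : ℝ) ^ (k - 1) * (n.choose k : ℝ) * v k
      = (-1 : ℝ) ^ r * v n := by
  have hC := hV.isCowanFunctional hr
  have hXm : Measurable fun ω => fun i => X i ω := measurable_pi_lambda _ hmeas
  have hcpt : ∀ (I : Set (Fin n)) (Y : Fin n → EuclideanSpace ℝ (Fin d)),
      IsCompact (convexHull ℝ (Y '' I)) :=
    fun I Y => ((Set.toFinite I).image Y).isCompact_convexHull ℝ
  have hcpt' : ∀ Y : Fin n → EuclideanSpace ℝ (Fin d), IsCompact (convexHull ℝ (Set.range Y)) :=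
    fun Y => (Set.finite_range Y).isCompact_convexHull ℝ
  have hI : ∀ I : Finset (Fin n),
      Integrable (fun ω => V r (convexHull ℝ ((fun i => X i ω) '' I))) P := by
    intro I
    refine hint.mono' ((hC.meas n I).comp hXm).aestronglyMeasurable (ae_of_all _ fun ω => ?_)
    have h0 : 0 ≤ V r (convexHull ℝ ((fun i => X i ω) '' I)) := by
      rw [← hC.empty]
      exact hC.mono _ _ convex_empty isCompact_empty (convex_convexHull _ _) (hcpt _ _)
        (Set.empty_subset _)
    rw [Real.norm_of_nonneg h0]
    exact hC.mono _ _ (convex_convexHull _ _) (hcpt _ _) (convex_convexHull _ _) (hcpt' _)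
      (convexHull_mono (Set.image_subset_range _ _))
  have hvI : ∀ I : Finset (Fin n),
      ∫ ω, V r (convexHull ℝ ((fun i => X i ω) '' I)) ∂P = v I.card := by
    intro I
    set J : Finset (Fin n) := Finset.univ.filter fun i => (i : ℕ) < I.card with hJ
    have hJc : J.card = I.card := by
      have := I.card_le_univ
      rw [Fintype.card_fin] at this
      rw [hJ, Fin.card_filter_val_lt, min_eq_right this]
    obtain ⟨σ, hσ⟩ : ∃ σ : Equiv.Perm (Fin n), J.map σ.toEmbedding = I := by
      refine ⟨(Finset.equivOfCardEq hJc).extendSubtype, Finset.eq_of_subset_of_card_le ?_ ?_⟩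
      · intro i hi
        obtain ⟨j, hj, rfl⟩ := Finset.mem_map.1 hi
        exact Equiv.extendSubtype_mem _ j hj
      · rw [Finset.card_map, hJc]
    have himg : ∀ ω, (fun i => X (σ i) ω) '' (J : Set (Fin n)) = (fun i => X i ω) '' I := by
      intro ω
      rw [← hσ]
      simp [Set.image_image]
    have hm := (hC.meas n J).stronglyMeasurable
    rw [hv]
    have h1 := integral_map (μ := P) hXm.aemeasurable hm.aestronglyMeasurable
    have h2 := integral_map (μ := P) (measurable_pi_lambda _ fun i => hmeas (σ i)).aemeasurable
      hm.aestronglyMeasurable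
    rw [hexch σ, h1] at h2
    simp only [himg] at h2
    rw [← h2]
    simp [hJ]
  have hsum := integral_congr_ae (μ := P) (ae_of_all P fun ω => hC.cowan n fun i => X i ω)
  simp only [integral_const_mul] at hsum
  rw [integral_finsetSum _ fun I _ => (hI I).const_mul _] at hsum
  have huniv : ∫ ω, V r (convexHull ℝ (Set.range fun i => X i ω)) ∂P = v n := by
    simpa using hvI Finset.univ
  have hv0 : v 0 = 0 := by
    simpa [hC.empty] using (hvI ∅).symm
  simp only [integral_const_mul, hvI, huniv] at hsum
  rw [← hsum, ← Finset.powerset_univ, Finset.sum_powerset_apply_card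
    (fun k => (-1 : ℝ) ^ (k + 1) * v k), Finset.card_univ, Fintype.card_fin,
    Finset.sum_range_succ', hv0, ← Finset.Ico_add_one_right_eq_Icc, Finset.sum_Ico_eq_sum_range]
  simp only [nsmul_eq_mul, mul_zero, add_zero, Nat.add_sub_cancel, Nat.add_sub_cancel_left]
  refine Finset.sum_congr rfl fun k _ => ?_
  rw [add_comm 1 k]
  ring
end
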